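/- Let n ≥ 1 and let Φ : FreeGroup (Fin n) ≃* FreeGroup (Fin n) be an automorphism. Then there is a finite set Λ of real numbers, each ≥ 1, such that for every x ∈ FreeGroup (Fin n) with x ≠ 1 there exists λ ∈ Λ with the sequence k ↦ (1/k)·log ‖Φ^k(x)‖_c converging to log λ as k → ∞. That is, as x ranges over all nontrivial conjugacy classes, only finitely many asymptotic exponential growth rates λ_{Φ,x} occur. -/

import Mathlib

/-- The cyclic (conjugacy) length of an element of a free group: the minimum of the
word length `FreeGroup.norm` over the conjugacy class. -/
noncomputable def cyclicLength {n : ℕ} (y : FreeGroup (Fin n)) : ℕ :=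
  sInf {m : ℕ | ∃ g : FreeGroup (Fin n), FreeGroup.norm (g * y * g⁻¹) = m}

namespace FreeGroup

theorem isReduced_of_isInfix {α : Type*} {s t : List (α × Bool)} (ht : IsReduced t)
    (h : s <:+: t) : IsReduced s := by
  obtain ⟨p, q, rfl⟩ := h
  rw [IsReduced, List.isChain_append, List.isChain_append] at ht
  exact ht.1.2.1

section Geometry

variable {α : Type*} [DecidableEq α]

/-- The distance between two elements in the Cayley tree of a free group. -/
def treeDist (u v : FreeGroup α) : ℤ := (u⁻¹ * v).norm

/-- Twice the Gromov product of `u` and `v` based at `w`. -/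
def gromovProd (u v w : FreeGroup α) : ℤ := treeDist w u + treeDist w v - treeDist u v

theorem treeDist_self (u : FreeGroup α) : treeDist u u = 0 := by simp [treeDist]

theorem treeDist_nonneg (u v : FreeGroup α) : 0 ≤ treeDist u v := by simp [treeDist]

theorem treeDist_comm (u v : FreeGroup α) : treeDist u v = treeDist v u := by
  unfold treeDist
  rw [← norm_inv_eq]
  simp

theorem treeDist_triangle (u v w : FreeGroup α) :
    treeDist u w ≤ treeDist u v + treeDist v w := by
  unfold treeDist
  have := norm_mul_le (u⁻¹ * v) (v⁻¹ * w)
  simp only [mul_assoc, mul_inv_cancel_left] at this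
  exact_mod_cast this

theorem treeDist_mul_left (g u v : FreeGroup α) : treeDist (g * u) (g * v) = treeDist u v := by
  simp [treeDist, mul_assoc]

theorem treeDist_one (u : FreeGroup α) : treeDist 1 u = u.norm := by simp [treeDist]

theorem treeDist_eq_zero {u v : FreeGroup α} : treeDist u v = 0 ↔ u = v := by
  simp [treeDist, inv_mul_eq_one]

theorem gromovProd_mul_left (g u v w : FreeGroup α) :
    gromovProd (g * u) (g * v) (g * w) = gromovProd u v w := by
  simp [gromovProd, treeDist_mul_left]

theorem gromovProd_nonneg (u v w : FreeGroup α) : 0 ≤ gromovProd u v w := by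
  have := treeDist_triangle u w v
  rw [treeDist_comm u w] at this
  unfold gromovProd
  omega

theorem gromovProd_comm (u v w : FreeGroup α) : gromovProd u v w = gromovProd v u w := by
  unfold gromovProd
  rw [treeDist_comm u v]
  omega

theorem toWord_mul_of_norm_eq {x y : FreeGroup α} (h : (x * y).norm = x.norm + y.norm) :
    (x * y).toWord = x.toWord ++ y.toWord :=
  (toWord_mul_sublist x y).eq_of_length (by simpa [norm] using h)

theorem isReduced_invRev_append_of_head_ne {s t : List (α × Bool)} (hs : IsReduced s)
    (ht : IsReduced t) (h : ∀ a ∈ s.head?, ∀ b ∈ t.head?, a ≠ b) :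
    IsReduced (invRev s ++ t) := by
  have hs' : IsReduced (invRev s) := by
    rw [isReduced_iff_reduce_eq, reduce_invRev, hs.reduce_eq]
  rw [IsReduced, List.isChain_append]
  refine ⟨hs', ht, ?_⟩
  rintro ⟨a, b⟩ hx ⟨c, d⟩ hy hac
  have hx' : s.head? = some (a, !b) := by
    simp [invRev] at hx
    grind
  have := h (a, !b) hx' (c, d) hy
  simp only at hac
  subst hac
  cases b <;> cases d <;> simp_all

theorem exists_common_initial_segment (s t : List (α × Bool)) (hs : IsReduced s)
    (ht : IsReduced t) :
    ∃ p s' t', s = p ++ s' ∧ t = p ++ t' ∧ IsReduced (invRev s' ++ t') := by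
  induction s generalizing t with
  | nil => exact ⟨[], [], t, rfl, rfl, by simpa [invRev] using ht⟩
  | cons a s ih =>
    cases t with
    | nil => exact ⟨[], a :: s, [], rfl, rfl,
        isReduced_invRev_append_of_head_ne hs ht (by simp)⟩
    | cons b t =>
      by_cases hab : a = b
      · subst hab
        obtain ⟨p, s', t', h1, h2, h3⟩ := ih t (isReduced_of_isInfix hs ⟨[a], [], by simp⟩)
          (isReduced_of_isInfix ht ⟨[a], [], by simp⟩)
        exact ⟨a :: p, s', t', by simp [h1], by simp [h2], h3⟩
      · exact ⟨[], a :: s, b :: t, rfl, rfl,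
          isReduced_invRev_append_of_head_ne hs ht (by simpa using hab)⟩

theorem norm_mk_of_isReduced {L : List (α × Bool)} (h : IsReduced L) : (mk L).norm = L.length := by
  rw [norm, toWord_mk, h.reduce_eq]

theorem exists_median_one (u v : FreeGroup α) :
    ∃ m, gromovProd 1 u m = 0 ∧ gromovProd 1 v m = 0 ∧ gromovProd u v m = 0 := by
  obtain ⟨p, s, t, hs, ht, hst⟩ :=
    exists_common_initial_segment u.toWord v.toWord isReduced_toWord isReduced_toWord
  have hu : u = mk p * mk s := by rw [mul_mk, ← hs, mk_toWord]
  have hv : v = mk p * mk t := by rw [mul_mk, ← ht, mk_toWord]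
  have hps : IsReduced (p ++ s) := hs ▸ isReduced_toWord
  have hpt : IsReduced (p ++ t) := ht ▸ isReduced_toWord
  have hp : IsReduced p := isReduced_of_isInfix hps ⟨[], s, by simp⟩
  have hs' : IsReduced s := isReduced_of_isInfix hps ⟨p, [], by simp⟩
  have ht' : IsReduced t := isReduced_of_isInfix hpt ⟨p, [], by simp⟩
  have e1 : treeDist 1 u = p.length + s.length := by
    rw [treeDist_one, hu, mul_mk, norm_mk_of_isReduced hps]; simp
  have e2 : treeDist 1 v = p.length + t.length := by
    rw [treeDist_one, hv, mul_mk, norm_mk_of_isReduced hpt]; simp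
  have e3 : treeDist (mk p) u = s.length := by
    rw [treeDist, hu, inv_mul_cancel_left, norm_mk_of_isReduced hs']
  have e4 : treeDist (mk p) v = t.length := by
    rw [treeDist, hv, inv_mul_cancel_left, norm_mk_of_isReduced ht']
  have e5 : treeDist u v = s.length + t.length := by
    rw [treeDist, hu, hv, mul_inv_rev, mul_assoc, inv_mul_cancel_left, inv_mk, mul_mk,
      norm_mk_of_isReduced hst]
    simp
  have e6 : treeDist (mk p) 1 = p.length := by
    rw [treeDist_comm, treeDist_one, norm_mk_of_isReduced hp]
  refine ⟨mk p, ?_, ?_, ?_⟩ <;> unfold gromovProd <;> omega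

theorem exists_median (a b c : FreeGroup α) :
    ∃ m, gromovProd a b m = 0 ∧ gromovProd a c m = 0 ∧ gromovProd b c m = 0 := by
  obtain ⟨m, h1, h2, h3⟩ := exists_median_one (a⁻¹ * b) (a⁻¹ * c)
  refine ⟨a * m, ?_, ?_, ?_⟩
  · rw [← gromovProd_mul_left a] at h1; simpa using h1
  · rw [← gromovProd_mul_left a] at h2; simpa using h2
  · rw [← gromovProd_mul_left a] at h3; simpa using h3

theorem toWord_eq_append_of_gromovProd_eq_zero {u p : FreeGroup α} (h : gromovProd 1 u p = 0) :
    u.toWord = p.toWord ++ (p⁻¹ * u).toWord := by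
  have := toWord_mul_of_norm_eq (x := p) (y := p⁻¹ * u) (by
    unfold gromovProd at h
    rw [treeDist_comm, treeDist_one, treeDist_one, treeDist] at h
    rw [mul_inv_cancel_left]
    omega)
  rwa [mul_inv_cancel_left] at this

theorem gromovProd_one_eq_zero_of_isPrefix {u p : FreeGroup α} (h : p.toWord <+: u.toWord) :
    gromovProd 1 u p = 0 := by
  obtain ⟨s, hs⟩ := h
  have hu : u = p * mk s := by
    conv_lhs => rw [← mk_toWord (x := u), ← hs, ← mul_mk, mk_toWord]
  have hred : IsReduced (p.toWord ++ s) := hs ▸ isReduced_toWord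
  unfold gromovProd
  rw [treeDist_comm, treeDist_one, treeDist_one, treeDist]
  conv_lhs => rw [hu, inv_mul_cancel_left,
    norm_mk_of_isReduced (isReduced_of_isInfix hred ⟨p.toWord, [], by simp⟩)]
  rw [← hu, norm, norm, ← hs]
  simp

theorem gromovProd_four_point (a b c w : FreeGroup α) :
    min (gromovProd a b w) (gromovProd b c w) ≤ gromovProd a c w := by
  wlog hw : w = 1 generalizing a b c w with H
  · have := H (w⁻¹ * a) (w⁻¹ * b) (w⁻¹ * c) 1 rfl
    rw [← gromovProd_mul_left w, ← gromovProd_mul_left w (w⁻¹ * b), ← gromovProd_mul_left w _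
      (w⁻¹ * c)] at this
    simpa using this
  subst hw
  wlog hle : gromovProd a b 1 ≤ gromovProd b c 1 generalizing a c with H
  · have := H c a (by rw [gromovProd_comm c b, gromovProd_comm b a]; omega)
    rw [gromovProd_comm c b, gromovProd_comm b a, gromovProd_comm c a] at this
    omega
  obtain ⟨p, h1, h2, h3⟩ := exists_median_one a b
  obtain ⟨q, k1, k2, k3⟩ := exists_median_one b c
  have hp := toWord_eq_append_of_gromovProd_eq_zero h2
  have hq := toWord_eq_append_of_gromovProd_eq_zero k1
  have hq' := toWord_eq_append_of_gromovProd_eq_zero k2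
  have e1 := treeDist_one p
  have e2 := treeDist_one q
  have hlen : p.norm ≤ q.norm := by
    have := treeDist_comm p 1
    have := treeDist_comm q 1
    have := treeDist_comm b a
    unfold gromovProd at *
    omega
  have hpq : p.toWord <+: q.toWord :=
    List.prefix_of_prefix_length_le ⟨_, hp.symm⟩ ⟨_, hq.symm⟩ hlen
  have hpc : gromovProd 1 c p = 0 :=
    gromovProd_one_eq_zero_of_isPrefix (hpq.trans ⟨_, hq'.symm⟩)
  have := treeDist_triangle a p c
  have := treeDist_comm a p
  have := treeDist_comm p 1
  unfold gromovProd at *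
  omega

theorem exists_between (u v : FreeGroup α) (i : ℤ) (h0 : 0 ≤ i) (hi : i ≤ treeDist u v) :
    ∃ w, gromovProd u v w = 0 ∧ treeDist u w = i := by
  lift i to ℕ using h0
  have hle : i ≤ (u⁻¹ * v).toWord.length := by
    have : (i : ℤ) ≤ ((u⁻¹ * v).norm : ℤ) := hi
    exact_mod_cast this
  have hr : IsReduced ((u⁻¹ * v).toWord.take i) :=
    isReduced_of_isInfix isReduced_toWord ⟨[], _, List.take_append_drop _ _⟩
  have hw : (mk ((u⁻¹ * v).toWord.take i)).toWord = (u⁻¹ * v).toWord.take i := by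
    rw [toWord_mk, hr.reduce_eq]
  refine ⟨u * mk ((u⁻¹ * v).toWord.take i), ?_, ?_⟩
  · have : gromovProd 1 (u⁻¹ * v) (mk ((u⁻¹ * v).toWord.take i)) = 0 :=
      gromovProd_one_eq_zero_of_isPrefix (by rw [hw]; exact ⟨_, List.take_append_drop _ _⟩)
    rw [← gromovProd_mul_left u] at this
    simpa using this
  · rw [treeDist, inv_mul_cancel_left, norm_mk_of_isReduced hr]
    simpa using hle

/-- If the endpoints of a segment through `w` are moved by less than their distance to `w`, the
new segment still passes through `w`. -/
theorem gromovProd_eq_zero_of_near {g h g' h' w : FreeGroup α} (hw : gromovProd g h w = 0)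
    (hg : treeDist g g' < treeDist w g) (hh : treeDist h h' < treeDist w h) :
    gromovProd g' h' w = 0 := by
  have f1 := gromovProd_four_point g g' h' w
  have f2 := gromovProd_four_point g h' h w
  have := gromovProd_nonneg g' h' w
  have := treeDist_triangle g g' w
  have := treeDist_triangle h h' w
  have := treeDist_triangle w g' g
  have := treeDist_triangle w h' h
  have := treeDist_comm w g
  have := treeDist_comm w h
  have := treeDist_comm w g'
  have := treeDist_comm w h'
  have := treeDist_comm g' g
  have := treeDist_comm h' h
  unfold gromovProd at *
  omega

end Geometry

end FreeGroup

/-- A betweenness relation of a median pretree: `B x y z` says that `y` lies on the segment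
from `x` to `z`. -/
structure IsMedianPretree {P : Type*} (B : P → P → P → Prop) : Prop where
  left : ∀ x y, B x x y
  symm : ∀ {x y z}, B x y z → B z y x
  sub : ∀ {x t z}, B x t z → ∀ y, B x t y ∨ B y t z
  antisymm : ∀ {x y z}, B x z y → B x y z → y = z
  median : ∀ a b c, ∃ m, B a m b ∧ B a m c ∧ B b m c

namespace IsMedianPretree

variable {P : Type*} {B : P → P → P → Prop}

/-- The setoid identifying two pairs that define the same direction at their first component. -/
def dirSetoid (hB : IsMedianPretree B) : Setoid (P × P) where
  r p q := p = q ∨ (p.1 = q.1 ∧ ¬ B p.2 p.1 q.2)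
  iseqv :=
    { refl := fun p => Or.inl rfl
      symm := by
        rintro p q (h | ⟨h, h'⟩)
        · exact Or.inl h.symm
        · exact Or.inr ⟨h.symm, fun hq => h' (by rw [h]; exact hB.symm hq)⟩
      trans := by
        rintro p q t (rfl | ⟨h, h'⟩) (rfl | ⟨k, k'⟩)
        · exact Or.inl rfl
        · exact Or.inr ⟨k, k'⟩
        · exact Or.inr ⟨h, h'⟩
        · refine Or.inr ⟨h.trans k, fun hpt => ?_⟩
          rcases hB.sub hpt q.2 with h1 | h1
          · exact h' h1
          · exact k' (h ▸ h1) }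

/-- The type of directions of a median pretree. -/
def Dir (hB : IsMedianPretree B) : Type _ := Quotient hB.dirSetoid

/-- The direction at `x` pointing towards `y`. -/
def mkDir (hB : IsMedianPretree B) (x y : P) : hB.Dir := Quotient.mk hB.dirSetoid (x, y)

theorem mkDir_eq (hB : IsMedianPretree B) {x y x' y' : P} :
    hB.mkDir x y = hB.mkDir x' y' ↔ (x = x' ∧ y = y') ∨ (x = x' ∧ ¬ B y x y') := by
  unfold mkDir
  refine (Quotient.eq (r := hB.dirSetoid)).trans ?_
  change ((x, y) = (x', y') ∨ _) ↔ _
  simp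

theorem right (hB : IsMedianPretree B) (x y : P) : B x y y := hB.symm (hB.left y x)

theorem eq_of_self (hB : IsMedianPretree B) {x y : P} (h : B x y x) : y = x :=
  hB.antisymm (x := x) (hB.left x y) h

theorem trans (hB : IsMedianPretree B) {x q a t : P} (h1 : B x q a) (h2 : B x t q) : B x t a := by
  rcases hB.sub h2 a with h | h
  · exact h
  · rcases hB.sub h1 t with h3 | h3
    · rw [← hB.antisymm h2 h3]; exact h1
    · have := hB.antisymm (x := a) h (hB.symm h3)
      rw [← this]; exact h1

theorem comparable (hB : IsMedianPretree B) {r x y z : P} (hy : B r y x) (hz : B r z x) :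
    B r y z ∨ B r z y := by
  rcases hB.sub hy z with h | h
  · exact Or.inl h
  rcases hB.sub hz y with h' | h'
  · exact Or.inr h'
  rw [hB.antisymm (x := x) (hB.symm h) (hB.symm h')]
  exact Or.inl (hB.right _ _)

theorem median_unique (hB : IsMedianPretree B) {a b c m m' : P} (h1 : B a m b) (h2 : B a m c)
    (h3 : B b m c)
    (k1 : B a m' b) (k2 : B a m' c) (k3 : B b m' c) : m = m' := by
  have key : ∀ {p q : P}, B a p b → B a p c → B b p c → B a q b → B a q c → B b q c →
      (B a p q ∧ B b p q) ∨ (B a p q ∧ B c p q) ∨ (B b p q ∧ B c p q) := by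
    intro p q h1 h2 h3 k1 k2 k3
    have s : ∀ {d}, B q p d → B d p q := fun h => hB.symm h
    rcases hB.sub h1 q with e1 | e1 <;> rcases hB.sub h2 q with e2 | e2 <;>
      rcases hB.sub h3 q with e3 | e3 <;> simp_all
  rcases key h1 h2 h3 k1 k2 k3 with ⟨p1, p2⟩ | ⟨p1, p2⟩ | ⟨p1, p2⟩ <;>
    rcases key k1 k2 k3 h1 h2 h3 with ⟨q1, q2⟩ | ⟨q1, q2⟩ | ⟨q1, q2⟩ <;>
    first
      | exact hB.antisymm q1 p1
      | exact hB.antisymm q1 p2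
      | exact hB.antisymm q2 p1
      | exact hB.antisymm q2 p2

/-- A finite set closed under medians. -/
def MedianClosed (B : P → P → P → Prop) (V : Finset P) : Prop :=
  ∀ a ∈ V, ∀ b ∈ V, ∀ c ∈ V, ∀ m, B a m b → B a m c → B b m c → m ∈ V

open Classical in
/-- Every nonempty finite set is contained in a finite median-closed set, all of whose new points
are interior. -/
theorem exists_medianClosed (hB : IsMedianPretree B) (S : Finset P) (r : P) :
    ∃ V : Finset P, S ⊆ V ∧ MedianClosed B V ∧
      ∀ x ∈ V, x ∉ S → ∃ y ∈ V, ∃ z ∈ V, y ≠ x ∧ z ≠ x ∧ B y x z := by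
  choose f f1 f2 f3 using fun a b => hB.median r a b
  have uniq : ∀ a b m, B r m a → B r m b → B a m b → m = f a b := fun a b m h1 h2 h3 =>
    hB.median_unique h1 h2 h3 (f1 a b) (f2 a b) (f3 a b)
  have fself : ∀ a, f a a = a := fun a =>
    (uniq a a a (hB.right _ _) (hB.right _ _) (hB.left _ _)).symm
  have fcomm : ∀ a b, f a b = f b a := fun a b =>
    uniq b a _ (f2 a b) (f1 a b) (hB.symm (f3 a b))
  -- the meet of `f a b` with `c` is `f a b` or `f a c`
  have key : ∀ a b c, f (f a b) c = f a b ∨ f (f a b) c = f a c := by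
    intro a b c
    rcases hB.comparable (f1 a b) (f1 a c) with h | h
    · left
      exact (uniq _ _ _ (hB.right _ _) (hB.trans (f2 a c) h) (hB.left _ _)).symm
    · right
      refine (uniq _ _ _ h (f2 a c) ?_).symm
      rcases hB.sub (f3 a c) (f a b) with h' | h'
      · have := hB.antisymm (x := a) (y := f a b) (z := f a c) h' ?_
        · rw [← this]; exact hB.left _ _
        · rcases hB.sub (f1 a b) (f a c) with h2 | h2
          · rw [hB.antisymm h2 h]; exact hB.right _ _
          · exact hB.symm h2
      · exact h'
  let V : Finset P := (S ×ˢ S).image fun p => f p.1 p.2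
  have hV : ∀ x, x ∈ V ↔ ∃ a ∈ S, ∃ b ∈ S, f a b = x := by
    intro x; simp [V, and_assoc]
  have meetclosed : ∀ x ∈ V, ∀ y ∈ V, f x y ∈ V := by
    intro x hx y hy
    obtain ⟨a, ha, b, hb, rfl⟩ := (hV x).1 hx
    obtain ⟨c, hc, d, hd, rfl⟩ := (hV y).1 hy
    have triple : ∀ e ∈ S, f (f c d) e ∈ V := by
      intro e he
      rcases key c d e with h | h <;> rw [h]
      · exact hy
      · exact (hV _).2 ⟨c, hc, e, he, rfl⟩
    rcases key a b (f c d) with h | h <;> rw [h]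
    · exact hx
    · rw [fcomm]; exact triple a ha
  refine ⟨V, fun a ha => (hV a).2 ⟨a, ha, a, ha, fself a⟩, ?_, ?_⟩
  · intro a ha b hb c hc m h1 h2 h3
    have e1 := hB.sub h1 r
    have e2 := hB.sub h2 r
    have e3 := hB.sub h3 r
    have s : ∀ d, B d m r → B r m d := fun d h => hB.symm h
    have key : (B r m a ∧ B r m b) ∨ (B r m a ∧ B r m c) ∨ (B r m b ∧ B r m c) := by
      have := s a; have := s b; have := s c
      tauto
    rcases key with ⟨k1, k2⟩ | ⟨k1, k2⟩ | ⟨k1, k2⟩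
    · rw [uniq a b m k1 k2 h1]; exact meetclosed a ha b hb
    · rw [uniq a c m k1 k2 h2]; exact meetclosed a ha c hc
    · rw [uniq b c m k1 k2 h3]; exact meetclosed b hb c hc
  · intro x hx hxS
    obtain ⟨a, ha, b, hb, rfl⟩ := (hV x).1 hx
    exact ⟨a, (hV a).2 ⟨a, ha, a, ha, fself a⟩, b, (hV b).2 ⟨b, hb, b, hb, fself b⟩,
      fun h => hxS (h ▸ ha), fun h => hxS (h ▸ hb), f3 a b⟩

open Classical in
/-- The directions defined by pairs of points of a finite set. -/
noncomputable def dirs (hB : IsMedianPretree B) (V : Finset P) : Finset hB.Dir :=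
  V.offDiag.image fun p => hB.mkDir p.1 p.2

theorem mem_dirs (hB : IsMedianPretree B) {V : Finset P} {d : hB.Dir} :
    d ∈ hB.dirs V ↔ ∃ x ∈ V, ∃ y ∈ V, x ≠ y ∧ hB.mkDir x y = d := by
  classical
  simp only [dirs, Finset.mem_image, Finset.mem_offDiag, Prod.exists]
  grind

open Classical in
theorem card_dirs (hB : IsMedianPretree B) {V : Finset P} (hV : MedianClosed B V)
    (hne : V.Nonempty) :
    (hB.dirs V).card + 2 = 2 * V.card := by
  obtain ⟨r, hr⟩ := hne
  let below : P → Finset P := fun x => V.filter fun z => B r z x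
  have below_lt : ∀ x ∈ V, ∀ z ∈ V, B r x z → x ≠ z → (below x).card < (below z).card := by
    intro x hx z hz h hne
    apply Finset.card_lt_card
    rw [Finset.ssubset_iff_of_subset]
    · refine ⟨z, by simp [below, hz, hB.right], ?_⟩
      simp only [below, Finset.mem_filter, not_and]
      intro _ h'
      exact hne (hB.antisymm h' h)
    · intro t ht
      simp only [below, Finset.mem_filter] at ht ⊢
      exact ⟨ht.1, hB.trans h ht.2⟩
  let IsPar : P → P → Prop := fun x y =>
    x ∈ V ∧ x ≠ y ∧ B r x y ∧ ∀ z ∈ V, z ≠ y → B r z y → B r z x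
  have par_ex : ∀ y, y ≠ r → ∃ x, IsPar x y := by
    intro y hyr
    obtain ⟨x, hx, hmax⟩ := Finset.exists_max_image
      (V.filter fun x => x ≠ y ∧ B r x y) (fun x => (below x).card)
      ⟨r, by simp [hr, hyr.symm, hB.left]⟩
    simp only [Finset.mem_filter] at hx hmax
    refine ⟨x, hx.1, hx.2.1, hx.2.2, fun z hz hzy hb => ?_⟩
    rcases hB.comparable hx.2.2 hb with h | h
    · by_cases hxz : x = z
      · subst hxz; exact h
      · have := below_lt x hx.1 z hz h hxz
        have := hmax z ⟨hz, hzy, hb⟩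
        omega
    · exact h
  choose! par hpar using par_ex
  have par_unique : ∀ x y, y ≠ r → IsPar x y → x = par y := by
    intro x y hy h
    have h' := hpar y hy
    exact hB.antisymm (h.2.2.2 _ h'.1 h'.2.1 h'.2.2.1) (h'.2.2.2 _ h.1 h.2.1 h.2.2.1)
  have hup : ((V.erase r).image fun x => hB.mkDir x r).card = (V.erase r).card := by
    apply Finset.card_image_of_injOn
    intro x _ x' _ h
    rcases hB.mkDir_eq.1 h with h | h <;> exact h.1
  have hdown : ((V.erase r).image fun y => hB.mkDir (par y) y).card = (V.erase r).card := by
    apply Finset.card_image_of_injOn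
    intro y hy y' hy' h
    simp only [Finset.coe_erase, Set.mem_sdiff, Finset.mem_coe, Set.mem_singleton_iff] at hy hy'
    rcases hB.mkDir_eq.1 h with h | ⟨h, hnb⟩
    · exact h.2
    · have p1 := hpar y hy.2
      have p2 := hpar y' hy'.2
      rw [← h] at p2
      obtain ⟨m, m1, m2, m3⟩ := hB.median r y y'
      have hm : m ∈ V := hV r hr y hy.1 y' hy'.1 m m1 m2 m3
      have hnot : ¬ B r m (par y) := by
        intro hm'
        rcases hB.sub p1.2.2.1 m with h1 | h1
        · rw [hB.antisymm hm' h1] at hnb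
          exact hnb m3
        · exact hnb (hB.trans m3 (hB.symm h1))
      have e1 : m = y := by
        by_contra hne
        exact hnot (p1.2.2.2 m hm hne m1)
      have e2 : m = y' := by
        by_contra hne
        exact hnot (p2.2.2.2 m hm hne m2)
      exact e1.symm.trans e2
  have hdisj : Disjoint ((V.erase r).image fun x => hB.mkDir x r)
      ((V.erase r).image fun y => hB.mkDir (par y) y) := by
    rw [Finset.disjoint_left]
    intro d h1 h2
    simp only [Finset.mem_image, Finset.mem_erase] at h1 h2
    obtain ⟨x, hx, rfl⟩ := h1
    obtain ⟨y, hy, h⟩ := h2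
    rcases hB.mkDir_eq.1 h with h | ⟨h, hnb⟩
    · exact hy.1 h.2
    · exact hnb (hB.symm (hpar y hy.1).2.2.1)
  have hunion : hB.dirs V = ((V.erase r).image fun x => hB.mkDir x r) ∪
      ((V.erase r).image fun y => hB.mkDir (par y) y) := by
    ext d
    simp only [Finset.mem_union, Finset.mem_image, Finset.mem_erase]
    constructor
    · intro hd
      obtain ⟨x, hx, y, hy, hxy, rfl⟩ := hB.mem_dirs.1 hd
      by_cases hb : B r x y
      · right
        obtain ⟨z, hz, hmin⟩ := Finset.exists_min_image
          (V.filter fun z => z ≠ x ∧ B r x z ∧ B r z y) (fun x => (below x).card)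
          ⟨y, by simp [hy, hxy.symm, hb, hB.right]⟩
        simp only [Finset.mem_filter] at hz hmin
        obtain ⟨hzV, hzx, hxz, hzy⟩ := hz
        have hzr : z ≠ r := by
          rintro rfl
          exact hzx (hB.eq_of_self hxz).symm
        have : IsPar x z := by
          refine ⟨hx, hzx.symm, hxz, fun t ht htz hbt => ?_⟩
          rcases hB.comparable hbt hxz with h | h
          · exact h
          · by_cases htx : t = x
            · subst htx; exact h
            · have := hmin t ⟨ht, htx, h, hB.trans hzy hbt⟩
              have := below_lt t ht z hzV hbt htz
              omega
        refine ⟨z, ⟨hzr, hzV⟩, ?_⟩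
        rw [← par_unique x z hzr this]
        refine hB.mkDir_eq.2 (Or.inr ⟨rfl, fun h => ?_⟩)
        rcases hB.sub hzy x with h' | h'
        · exact hzx (hB.antisymm hxz h')
        · exact hzx (hB.antisymm (x := y) (hB.symm h) (hB.symm h'))
      · left
        have hxr : x ≠ r := by
          rintro rfl
          exact hb (hB.left _ _)
        exact ⟨x, ⟨hxr, hx⟩, hB.mkDir_eq.2 (Or.inr ⟨rfl, hb⟩)⟩
    · rintro (⟨x, hx, rfl⟩ | ⟨y, hy, rfl⟩)
      · exact hB.mem_dirs.2 ⟨x, hx.2, r, hr, hx.1, rfl⟩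
      · have := hpar y hy.1
        exact hB.mem_dirs.2 ⟨_, this.1, y, hy.2, this.2.1, rfl⟩
  rw [hunion, Finset.card_union_of_disjoint hdisj, hup, hdown, Finset.card_erase_of_mem hr]
  have : 0 < V.card := Finset.card_pos.2 ⟨r, hr⟩
  omega

end IsMedianPretree

/-- An action of a group on a median pretree by automorphisms that are non-nesting at fixed points
and such that only the identity fixes two distinct points. -/
structure IsArcFreeAction (G : Type*) [Group G] {P : Type*} [MulAction G P]
    (B : P → P → P → Prop) : Prop extends IsMedianPretree B where
  smul : ∀ (g : G) {x y z : P}, B x y z → B (g • x) (g • y) (g • z)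
  nonnesting : ∀ (g : G) {x m : P}, g • x = x → B x (g • m) m → g • m = m
  arc_trivial : ∀ (g : G) {x y : P}, g • x = x → g • y = y → x ≠ y → g = 1

namespace FreeGroup

variable {ι Q : Type*} [MulAction (FreeGroup ι) Q]

/-- A `ZMod 2`-valued cochain on a free orbit of a free group is a coboundary. -/
theorem exists_coboundary (η : ι → Q → ZMod 2) :
    ∃ f : Q → ZMod 2, ∀ i q, (∀ g : FreeGroup ι, g • q = q → g = 1) →
      f (of i • q) = f q + η i q := by
  classical
  let T : ι → Equiv.Perm (Q × ZMod 2) := fun i =>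
    { toFun := fun p => (of i • p.1, p.2 + η i p.1)
      invFun := fun p => ((of i)⁻¹ • p.1, p.2 - η i ((of i)⁻¹ • p.1))
      left_inv := fun p => by simp
      right_inv := fun p => by simp }
  let ρ : FreeGroup ι →* Equiv.Perm (Q × ZMod 2) := lift T
  have hρ1 : ∀ g p, (ρ g p).1 = g • p.1 := by
    intro g
    induction g using FreeGroup.induction_on with
    | C1 => intro p; simp
    | of i => intro p; simp [ρ, T]
    | inv_of i _ =>
      intro p
      simp only [ρ, _root_.map_inv, lift_apply_of]
      rfl
    | mul x y hx hy => intro p; rw [_root_.map_mul, Equiv.Perm.mul_apply, hx, hy, mul_smul]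
  have hex : ∀ q : Q, ∃ g : FreeGroup ι,
      g • (Quotient.out (s := MulAction.orbitRel (FreeGroup ι) Q) (Quotient.mk _ q)) = q := by
    intro q
    have h := Quotient.mk_out (s := MulAction.orbitRel (FreeGroup ι) Q) q
    exact MulAction.mem_orbit_iff.1 ((MulAction.orbitRel (FreeGroup ι) Q).symm h)
  choose γ hγ using hex
  refine ⟨fun q => (ρ (γ q)
    (Quotient.out (s := MulAction.orbitRel (FreeGroup ι) Q) (Quotient.mk _ q), 0)).2, ?_⟩
  intro i q hq
  have hrep : (Quotient.mk (MulAction.orbitRel (FreeGroup ι) Q) (of i • q)) = Quotient.mk _ q :=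
    Quotient.sound (MulAction.mem_orbit q (of i))
  have h1 := hγ (of i • q)
  have h2 := hγ q
  simp only
  rw [hrep] at h1 ⊢
  set q0 := Quotient.out (s := MulAction.orbitRel (FreeGroup ι) Q) (Quotient.mk _ q)
  have h3 : γ (of i • q) = of i * γ q := by
    have : (γ q * ((of i * γ q)⁻¹ * γ (of i • q)) * (γ q)⁻¹) • q = q := by
      have hq0 : (γ q)⁻¹ • q = q0 := by rw [inv_smul_eq_iff, h2]
      rw [mul_smul, hq0, mul_smul, mul_smul, h1, mul_inv_rev, mul_smul, inv_smul_smul, hq0, h2]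
    have := hq _ this
    rw [conj_eq_one_iff, inv_mul_eq_one] at this
    exact this.symm
  rw [h3, _root_.map_mul, Equiv.Perm.mul_apply]
  have : (ρ (γ q) (q0, 0)).1 = q := by rw [hρ1]; exact h2
  rw [show ρ (of i) = T i by simp [ρ]]
  change _ + η i (ρ (γ q) (q0, 0)).1 = _
  rw [this]

variable {P : Type*} [MulAction (FreeGroup ι) P]

/-- `WalkIn V x g` says that the reading of some word for `g`, letter by letter from the right,
moves `x` inside `V`. -/
inductive WalkIn (V : Finset P) (x : P) : FreeGroup ι → Prop
  | one : WalkIn V x 1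
  | mul (i : ι) (g : FreeGroup ι) : WalkIn V x g → of i • g • x ∈ V → WalkIn V x (of i * g)
  | inv (i : ι) (g : FreeGroup ι) : WalkIn V x g → (of i)⁻¹ • g • x ∈ V →
      WalkIn V x ((of i)⁻¹ * g)

namespace WalkIn

variable {V : Finset P} {x : P} {g h : FreeGroup ι}

theorem smul_mem (hg : WalkIn V x g) (hx : x ∈ V) : g • x ∈ V := by
  cases hg with
  | one => simpa using hx
  | mul i g _ h => rwa [mul_smul]
  | inv i g _ h => rwa [mul_smul]

theorem comp (hg : WalkIn V x g) (hh : WalkIn V (g • x) h) : WalkIn V x (h * g) := by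
  induction hh with
  | one => simpa using hg
  | mul i k _ hk ih => rw [mul_assoc]; exact mul i _ ih (by rwa [mul_smul])
  | inv i k _ hk ih => rw [mul_assoc]; exact inv i _ ih (by rwa [mul_smul])

theorem reverse (hg : WalkIn V x g) (hx : x ∈ V) : WalkIn V (g • x) g⁻¹ := by
  induction hg with
  | one => simpa using one
  | mul i k hk hm ih =>
    rw [mul_inv_rev]
    have : WalkIn V ((of i * k) • x) (of i)⁻¹ := by
      have := inv (V := V) (x := (of i * k) • x) i 1 one
        (by simpa [mul_smul] using hk.smul_mem hx)
      simpa using this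
    refine this.comp ?_
    simpa [mul_smul] using ih
  | inv i k hk hm ih =>
    rw [mul_inv_rev, inv_inv]
    have : WalkIn V (((of i)⁻¹ * k) • x) (of i) := by
      have := mul (V := V) (x := ((of i)⁻¹ * k) • x) i 1 one
        (by simpa [mul_smul] using hk.smul_mem hx)
      simpa using this
    refine this.comp ?_
    simpa [mul_smul] using ih

end WalkIn

/-- The equivalence relation on the points of `V` generated by the partial action of the
generators. -/
def walkSetoid (ι : Type*) {P : Type*} [MulAction (FreeGroup ι) P] (V : Finset P) : Setoid V where
  r x y := ∃ g : FreeGroup ι, WalkIn V x.1 g ∧ g • x.1 = y.1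
  iseqv :=
    { refl := fun x => ⟨1, WalkIn.one, by simp⟩
      symm := by
        rintro x y ⟨g, hg, h⟩
        refine ⟨g⁻¹, h ▸ hg.reverse x.2, by rw [← h, inv_smul_smul]⟩
      trans := by
        rintro x y z ⟨g, hg, h⟩ ⟨k, hk, h'⟩
        exact ⟨k * g, hg.comp (h ▸ hk), by rw [mul_smul, h, h']⟩ }

/-- The closed walks at a point of `V`. -/
def loopsIn (V : Finset P) {x : P} (hx : x ∈ V) : Subgroup (FreeGroup ι) where
  carrier := {g | WalkIn V x g ∧ g • x = x}
  one_mem' := ⟨WalkIn.one, by simp⟩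
  mul_mem' := by
    rintro a b ⟨ha, ha'⟩ ⟨hb, hb'⟩
    exact ⟨hb.comp (by rwa [hb']), by rw [mul_smul, hb', ha']⟩
  inv_mem' := by
    rintro a ⟨ha, ha'⟩
    refine ⟨?_, by rw [inv_smul_eq_iff, ha']⟩
    have := ha.reverse hx
    rwa [ha'] at this

theorem mem_loopsIn {V : Finset P} {x : P} {hx : x ∈ V} {g : FreeGroup ι} :
    g ∈ loopsIn V hx ↔ WalkIn V x g ∧ g • x = x := Iff.rfl

end FreeGroup

namespace IsArcFreeAction

variable {G : Type*} [Group G] {P : Type*} [MulAction G P] {B : P → P → P → Prop}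

theorem smul_iff (hA : IsArcFreeAction G B) (g : G) {x y z : P} :
    B (g • x) (g • y) (g • z) ↔ B x y z :=
  ⟨fun h => by simpa using hA.smul g⁻¹ h, hA.smul g⟩

/-- The action on directions. -/
abbrev dirAction (hA : IsArcFreeAction G B) : MulAction G hA.toIsMedianPretree.Dir where
  smul g := Quotient.map (sa := hA.toIsMedianPretree.dirSetoid)
    (sb := hA.toIsMedianPretree.dirSetoid) (fun p => (g • p.1, g • p.2)) (by
      rintro p q (rfl | ⟨h, h'⟩)
      · exact Or.inl rfl
      · exact Or.inr ⟨by simp [h], fun h2 => h' ((hA.smul_iff g).1 h2)⟩)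
  one_smul := by
    rintro ⟨x, y⟩
    change Quotient.mk _ _ = Quotient.mk _ _
    simp
  mul_smul := by
    rintro g h ⟨x, y⟩
    change Quotient.mk _ _ = Quotient.mk _ _
    simp [mul_smul]

theorem dir_free (hA : IsArcFreeAction G B) {g : G} {x y : P} (hxy : x ≠ y) (hg : g • x = x)
    (h : hA.mkDir (g • x) (g • y) = hA.mkDir x y) : g = 1 := by
  rcases hA.mkDir_eq.1 h with ⟨_, h⟩ | ⟨_, h⟩
  · exact hA.arc_trivial g hg h hxy
  · rw [hg] at h
    obtain ⟨m, m1, m2, m3⟩ := hA.median x y (g • y)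
    have hmx : x ≠ m := by
      rintro rfl
      exact h (hA.symm m3)
    refine hA.arc_trivial g hg ?_ hmx
    have h1 : B x (g • m) (g • y) := by simpa [hg] using hA.smul g m1
    rcases hA.comparable h1 m2 with h' | h'
    · exact hA.nonnesting g hg h'
    · have hg' : g⁻¹ • x = x := by rw [inv_smul_eq_iff, hg]
      have h2 : B x (g⁻¹ • m) m := by simpa [hg'] using hA.smul g⁻¹ h'
      have := hA.nonnesting g⁻¹ hg' h2
      rw [inv_smul_eq_iff] at this
      exact this.symm

end IsArcFreeAction

namespace FreeGroup

variable {ι P : Type*} [MulAction (FreeGroup ι) P]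

open Classical in
/-- The points of `V` that the `i`-th generator keeps in `V`. -/
noncomputable def partialDomain (V : Finset P) (i : ι) : Finset P :=
  V.filter fun x => of i • x ∈ V

theorem mem_partialDomain {V : Finset P} {i : ι} {x : P} :
    x ∈ partialDomain V i ↔ x ∈ V ∧ of i • x ∈ V := by
  classical
  simp [partialDomain]

open Classical in
/-- Counting cochains on the graph of a partial action of a free group on a finite set. -/
theorem card_add_sum_le_sum_partialDomain [Fintype ι] (V : Finset P)
    (b : Quotient (walkSetoid ι V) → V) (hb : ∀ C, Quotient.mk _ (b C) = C)
    (r : Quotient (walkSetoid ι V) → ℕ)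
    (χ : ∀ C, Fin (r C) → FreeGroup ι → ZMod 2)
    (hχ : ∀ C a, ∀ g ∈ loopsIn V (b C).2, ∀ h ∈ loopsIn V (b C).2,
      χ C a (g * h) = χ C a g + χ C a h)
    (x : ∀ C, Fin (r C) → FreeGroup ι) (hx : ∀ C a, x C a ∈ loopsIn V (b C).2)
    (hχx : ∀ C a a', χ C a (x C a') = if a = a' then 1 else 0) :
    V.card + ∑ C, r C ≤ ∑ i : ι, (partialDomain V i).card +
      Fintype.card (Quotient (walkSetoid ι V)) := by
  have hγex : ∀ y : V, ∃ g : FreeGroup ι, WalkIn V (b (Quotient.mk _ y)).1 g ∧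
      g • (b (Quotient.mk _ y)).1 = y.1 ∧ (b (Quotient.mk _ y) = y → g = 1) := by
    intro y
    by_cases h : b (Quotient.mk _ y) = y
    · exact ⟨1, WalkIn.one, by simp [h], fun _ => rfl⟩
    · obtain ⟨g, hg, hg'⟩ := Quotient.exact (hb (Quotient.mk _ y))
      exact ⟨g, hg, hg', fun h' => absurd h' h⟩
  choose γ hγ1 hγ2 hγ3 using hγex
  have hcomp : ∀ C (y : V) (g : FreeGroup ι), WalkIn V (b C).1 g → g • (b C).1 = y.1 →
      Quotient.mk _ y = C := by
    intro C y g hg hy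
    rw [← hb C]
    exact (Quotient.sound (s := walkSetoid ι V) ⟨g, hg, hy⟩).symm
  have hloop : ∀ C (y : V) (g : FreeGroup ι), WalkIn V (b C).1 g → g • (b C).1 = y.1 →
      (γ y)⁻¹ * g ∈ loopsIn V (b C).2 := by
    intro C y g hg hy
    obtain rfl := hcomp C y g hg hy
    have := (hγ1 y).reverse (b _).2
    rw [hγ2] at this
    exact ⟨hg.comp (by rwa [hy]), by rw [mul_smul, hy, inv_smul_eq_iff, hγ2]⟩
  have hγ1' : ∀ C (y : V), Quotient.mk _ y = C → WalkIn V (b C).1 (γ y) := by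
    rintro _ y rfl; exact hγ1 y
  have hγ2' : ∀ C (y : V), Quotient.mk _ y = C → γ y • (b C).1 = y.1 := by
    rintro _ y rfl; exact hγ2 y
  have hχ1 : ∀ C a, χ C a 1 = 0 := by
    intro C a
    have := hχ C a 1 (one_mem _) 1 (one_mem _)
    simpa using this
  let Θ : (V → ZMod 2) × ((Σ C, Fin (r C)) → ZMod 2) →
      ((Σ i, partialDomain V i) → ZMod 2) × (Quotient (walkSetoid ι V) → ZMod 2) := fun p =>
    (fun q => p.1 ⟨of q.1 • q.2.1, (mem_partialDomain.1 q.2.2).2⟩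
        - p.1 ⟨q.2.1, (mem_partialDomain.1 q.2.2).1⟩
        - ∑ a, p.2 ⟨Quotient.mk _ ⟨q.2.1, (mem_partialDomain.1 q.2.2).1⟩, a⟩ *
          χ _ a ((γ ⟨of q.1 • q.2.1, (mem_partialDomain.1 q.2.2).2⟩)⁻¹ *
            (of q.1 * γ ⟨q.2.1, (mem_partialDomain.1 q.2.2).1⟩)),
      fun C => p.1 (b C))
  have hinj : Function.Injective Θ := by
    rintro ⟨f, c⟩ ⟨f', c'⟩ h
    have h1 := fun q => congrFun (congrArg Prod.fst h) q
    have h2 := fun C => congrFun (congrArg Prod.snd h) C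
    simp only [Θ] at h1 h2
    have hstep : ∀ C i (y y' : V), y'.1 = of i • y.1 → Quotient.mk _ y = C →
        f y' - f' y' = f y - f' y + ∑ a, (c ⟨C, a⟩ - c' ⟨C, a⟩) *
          χ C a ((γ y')⁻¹ * (of i * γ y)) := by
      rintro C i ⟨y, hy⟩ ⟨y', hy'⟩ rfl rfl
      have := h1 ⟨i, ⟨y, mem_partialDomain.2 ⟨hy, hy'⟩⟩⟩
      simp only [sub_mul, Finset.sum_sub_distrib] at this ⊢
      linear_combination this
    have hwalk : ∀ C (g : FreeGroup ι), WalkIn V (b C).1 g → ∀ y : V, g • (b C).1 = y.1 →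
        f y - f' y = ∑ a, (c ⟨C, a⟩ - c' ⟨C, a⟩) * χ C a ((γ y)⁻¹ * g) := by
      intro C g hg
      induction hg with
      | one =>
        intro y hy
        rw [one_smul] at hy
        obtain rfl := Subtype.ext hy
        rw [hγ3 _ (by rw [hb])]
        simp [hχ1, h2]
      | mul i g hg hm ih =>
        intro y hy
        have hm0 : g • (b C).1 ∈ V := hg.smul_mem (b C).2
        have hC := hcomp C ⟨_, hm0⟩ g hg rfl
        have e1 := hstep C i ⟨_, hm0⟩ y (by rw [← hy, mul_smul]) hC
        have e2 := ih ⟨_, hm0⟩ rfl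
        rw [e1, e2, ← Finset.sum_add_distrib]
        refine Finset.sum_congr rfl fun a _ => ?_
        rw [← mul_add, add_comm, ← hχ]
        · congr 2; group
        · refine hloop _ _ _ ((hγ1' _ _ hC).comp ?_) (by rw [mul_smul, hγ2' _ _ hC, ← hy, mul_smul])
          rw [hγ2' _ _ hC]
          have := WalkIn.mul (V := V) (x := g • (b C).1) i 1 WalkIn.one (by simpa using hm)
          simpa using this
        · exact hloop _ _ _ hg rfl
      | inv i g hg hm ih =>
        intro y hy
        have hm0 : g • (b C).1 ∈ V := hg.smul_mem (b C).2
        have hC0 := hcomp C ⟨_, hm0⟩ g hg rfl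
        have hC := hcomp C y _ (WalkIn.inv i g hg hm) hy
        have hy2 : of i • y.1 = g • (b C).1 := by rw [← hy, mul_smul, smul_inv_smul]
        have e1 := hstep C i y ⟨_, hm0⟩ hy2.symm hC
        have e2 := ih ⟨_, hm0⟩ rfl
        rw [e2] at e1
        rw [← sub_eq_iff_eq_add, ← Finset.sum_sub_distrib] at e1
        rw [← e1]
        refine Finset.sum_congr rfl fun a _ => ?_
        rw [← mul_sub]
        congr 1
        rw [sub_eq_iff_eq_add', ← hχ]
        · congr 1; group
        · have w := hloop C ⟨_, hm0⟩ (of i * γ y) ?_ ?_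
          · exact w
          · refine (hγ1' _ _ hC).comp ?_
            rw [hγ2' _ _ hC]
            have := WalkIn.mul (V := V) (x := y.1) i 1 WalkIn.one (by simpa [hy2] using hm0)
            simpa using this
          · rw [mul_smul, hγ2' _ _ hC, hy2]
        · exact hloop C y _ (WalkIn.inv i g hg hm) hy
    have hc : ∀ C a, c ⟨C, a⟩ - c' ⟨C, a⟩ = 0 := by
      intro C a
      have e := hwalk C (x C a) (hx C a).1 (b C) (hx C a).2
      rw [hγ3 _ (by rw [hb])] at e
      simpa [hχx, h2, eq_comm] using e
    have hf : f = f' := by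
      funext y
      have e := hwalk _ _ (hγ1 y) y (hγ2 y)
      simp only [hc, zero_mul, Finset.sum_const_zero] at e
      exact sub_eq_zero.1 e
    have hcc : c = c' := by
      funext ⟨C, a⟩
      exact sub_eq_zero.1 (hc C a)
    rw [hf, hcc]
  have := Fintype.card_le_of_injective Θ hinj
  simp only [Fintype.card_prod, Fintype.card_fun, ZMod.card, ← pow_add, Fintype.card_sigma,
    Fintype.card_fin, Fintype.card_coe] at this
  exact (Nat.pow_le_pow_iff_right (by norm_num)).1 this

end FreeGroup

namespace IsMedianPretree

variable {P : Type*} {B : P → P → P → Prop}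

/-- The base point of a direction. -/
def base (hB : IsMedianPretree B) : hB.Dir → P :=
  Quotient.lift (s := hB.dirSetoid) Prod.fst (by
    rintro p q (rfl | h)
    · rfl
    · exact h.1)

theorem base_mem (hB : IsMedianPretree B) {V : Finset P} {d : hB.Dir} (hd : d ∈ hB.dirs V) :
    hB.base d ∈ V := by
  obtain ⟨x, hx, y, _, _, rfl⟩ := hB.mem_dirs.1 hd
  exact hx

end IsMedianPretree

namespace IsArcFreeAction

open FreeGroup

variable {ι P : Type*} [MulAction (FreeGroup ι) P] {B : P → P → P → Prop}

open Classical in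
/-- Counting cochains on the directions defined by a finite set. -/
theorem sum_card_dirs_partialDomain_le [Fintype ι] (hA : IsArcFreeAction (FreeGroup ι) B)
    (V : Finset P)
    (b : Quotient (walkSetoid ι V) → V) (hb : ∀ C, Quotient.mk _ (b C) = C)
    (hdir : ∀ C, ∃ y ∈ V, y ≠ (b C).1)
    (T : Finset (Quotient (walkSetoid ι V)))
    (hT : ∀ C ∈ T, ∀ g : FreeGroup ι, g ∈ loopsIn V (b C).2 → g = 1)
    (hT2 : ∀ C ∈ T, ∃ y ∈ V, ∃ z ∈ V, y ≠ (b C).1 ∧ z ≠ (b C).1 ∧ B y (b C).1 z) :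
    ∑ i : ι, (hA.dirs (partialDomain V i)).card + Fintype.card (Quotient (walkSetoid ι V)) +
      T.card ≤
      (hA.dirs V).card := by
  let _ := hA.dirAction
  have hsmul : ∀ (g : FreeGroup ι) x y, g • hA.mkDir x y = hA.mkDir (g • x) (g • y) :=
    fun _ _ _ => rfl
  have hbase : ∀ (g : FreeGroup ι) (d : hA.Dir), hA.base (g • d) = g • hA.base d := by
    rintro g ⟨x, y⟩; rfl
  choose f hf using exists_coboundary (ι := ι) (Q := hA.Dir)
  have hsub : ∀ i : ι, ∀ d ∈ hA.dirs (partialDomain V i), d ∈ hA.dirs V ∧ of i • d ∈ hA.dirs V := by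
    intro i d hd
    obtain ⟨x, hx, y, hy, hxy, rfl⟩ := hA.mem_dirs.1 hd
    rw [mem_partialDomain] at hx hy
    exact ⟨hA.mem_dirs.2 ⟨x, hx.1, y, hy.1, hxy, rfl⟩,
      hA.mem_dirs.2 ⟨_, hx.2, _, hy.2, by simpa using hxy, rfl⟩⟩
  have hfree : ∀ d ∈ hA.dirs V, ∀ g : FreeGroup ι, g • d = d → g = 1 := by
    intro d hd g hg
    obtain ⟨x, hx, y, hy, hxy, rfl⟩ := hA.mem_dirs.1 hd
    have : g • x = x := by
      have h := congrArg hA.base hg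
      rwa [hbase] at h
    exact hA.dir_free hxy this hg
  have hd0 : ∀ C, ∃ d ∈ hA.dirs V, hA.base d = b C := by
    intro C
    obtain ⟨y, hy, hne⟩ := hdir C
    exact ⟨_, hA.mem_dirs.2 ⟨_, (b C).2, y, hy, hne.symm, rfl⟩, rfl⟩
  choose d0 hd0 hd0b using hd0
  have hd1 : ∀ C ∈ T, ∃ d ∈ hA.dirs V, hA.base d = b C ∧ d ≠ d0 C := by
    intro C hC
    obtain ⟨y, hy, z, hz, hyb, hzb, hbt⟩ := hT2 C hC
    by_cases h : hA.mkDir (b C).1 y = d0 C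
    · refine ⟨_, hA.mem_dirs.2 ⟨_, (b C).2, z, hz, hzb.symm, rfl⟩, rfl, fun h' => ?_⟩
      rcases hA.mkDir_eq.1 (h.trans h'.symm) with ⟨_, h2⟩ | ⟨_, h2⟩
      · subst h2
        exact hyb (hA.eq_of_self hbt).symm
      · exact h2 hbt
    · exact ⟨_, hA.mem_dirs.2 ⟨_, (b C).2, y, hy, hyb.symm, rfl⟩, rfl, h⟩
  let cls : hA.dirs V → Quotient (walkSetoid ι V) := fun d =>
    Quotient.mk _ ⟨hA.base d.1, hA.base_mem d.2⟩
  let u : hA.dirs V → ZMod 2 := fun d =>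
    if ∃ g : FreeGroup ι, WalkIn V (b (cls d)).1 g ∧ d.1 = g • d0 (cls d) then 1 else 0
  have hcls : ∀ (i : ι) d (h : d ∈ hA.dirs V) (h' : of i • d ∈ hA.dirs V),
      cls ⟨of i • d, h'⟩ = cls ⟨d, h⟩ := by
    intro i d h h'
    refine (Quotient.sound (s := walkSetoid ι V) ⟨of i, ?_, ?_⟩).symm
    · have := WalkIn.mul (V := V) (x := hA.base d) i 1 WalkIn.one (by
        simpa [hbase] using hA.base_mem h')
      simpa using this
    · simp [hbase]
  have hu : ∀ (i : ι) d (h : d ∈ hA.dirs V) (h' : of i • d ∈ hA.dirs V),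
      u ⟨of i • d, h'⟩ = u ⟨d, h⟩ := by
    intro i d h h'
    simp only [u, hcls i d h h']
    congr 1
    simp only [eq_iff_iff]
    have m := hA.base_mem h
    have m' := hA.base_mem h'
    constructor
    · rintro ⟨g, hg, he⟩
      refine ⟨(of i)⁻¹ * g, WalkIn.inv i g hg ?_, ?_⟩
      · rw [hbase] at m'
        have : g • (b (cls ⟨d, h⟩)).1 = of i • hA.base d := by
          rw [← hd0b, ← hbase, ← he, hbase]
        rw [this, inv_smul_smul]; exact m
      · rw [mul_smul, ← he, inv_smul_smul]
    · rintro ⟨g, hg, he⟩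
      refine ⟨of i * g, WalkIn.mul i g hg ?_, ?_⟩
      · have : g • (b (cls ⟨d, h⟩)).1 = hA.base d := by
          rw [← hd0b, ← hbase, ← he]
        rw [this, ← hbase]; exact m'
      · rw [mul_smul, ← he]
  have hclsb : ∀ C d (h : d ∈ hA.dirs V), hA.base d = b C → cls ⟨d, h⟩ = C := by
    intro C d h hd
    rw [← hb C]
    simp only [cls, hd, Subtype.coe_eta]
  let ext : ((Σ i, hA.dirs (partialDomain V i)) → ZMod 2) → ι → hA.Dir → ZMod 2 := fun η i d =>
    if h : d ∈ hA.dirs (partialDomain V i) then η ⟨i, d, h⟩ else 0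
  let Θ : ((Σ i, hA.dirs (partialDomain V i)) → ZMod 2) ×
      (Quotient (walkSetoid ι V) → ZMod 2) × (T → ZMod 2) → (hA.dirs V → ZMod 2) := fun p d =>
    f (ext p.1) d + p.2.1 (cls d) + if h : cls d ∈ T then p.2.2 ⟨cls d, h⟩ * u d else 0
  have hinj : Function.Injective Θ := by
    rintro ⟨η, h1, h2⟩ ⟨η', h1', h2'⟩ h
    have e := fun d => congrFun h d
    simp only [Θ] at e
    have hη : η = η' := by
      funext ⟨i, d, hd⟩
      obtain ⟨m, m'⟩ := hsub i d hd
      have e1 := e ⟨d, m⟩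
      have e2 := e ⟨of i • d, m'⟩
      simp only [hcls i d m m', hu i d m m', hf _ i d (hfree d m)] at e2
      simp only [ext, hd, dite_true] at e1 e2
      linear_combination e2 - e1
    subst hη
    have key : ∀ C ∈ T, h1 C = h1' C := by
      intro C hC
      obtain ⟨d, hd, hdb, hne⟩ := hd1 C hC
      have e1 := e ⟨d, hd⟩
      have hu0 : u ⟨d, hd⟩ = 0 := by
        simp only [u, hclsb C d hd hdb]
        rw [if_neg]
        rintro ⟨g, hg, he⟩
        have : g = 1 := by
          refine hT C hC g (mem_loopsIn.2 ⟨hg, ?_⟩)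
          rw [← hd0b, ← hbase, ← he, hdb, hd0b]
        rw [this, one_smul] at he
        exact hne he
      rw [hu0] at e1
      simp only [hclsb C d hd hdb, mul_zero, dite_eq_ite, ite_self, add_zero] at e1
      exact add_left_cancel e1
    have key2 : h1 = h1' := by
      funext C
      by_cases hC : C ∈ T
      · exact key C hC
      · have e1 := e ⟨d0 C, hd0 C⟩
        simp only [hclsb C _ (hd0 C) (hd0b C), hC, dite_false, add_zero] at e1
        exact add_left_cancel e1
    subst key2
    have key3 : h2 = h2' := by
      funext ⟨C, hC⟩
      have e1 := e ⟨d0 C, hd0 C⟩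
      have hu1 : u ⟨d0 C, hd0 C⟩ = 1 := by
        simp only [u, hclsb C _ (hd0 C) (hd0b C)]
        rw [if_pos]
        exact ⟨1, WalkIn.one, (one_smul _ _).symm⟩
      rw [hu1] at e1
      simp only [hclsb C _ (hd0 C) (hd0b C), hC, dite_true, mul_one] at e1
      exact add_left_cancel e1
    rw [key3]
  have := Fintype.card_le_of_injective Θ hinj
  simp only [Fintype.card_prod, Fintype.card_fun, ZMod.card, ← pow_add, Fintype.card_sigma,
    Fintype.card_coe] at this
  rw [add_assoc]
  exact (Nat.pow_le_pow_iff_right (by norm_num)).1 this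

end IsArcFreeAction

namespace FreeGroup

/-- The mod 2 characters dual to a free basis of a subgroup. -/
theorem exists_dual_characters {G κ : Type*} [Group G] [DecidableEq κ] {L : Subgroup G}
    (b : FreeGroupBasis κ L) :
    ∃ χ : κ → G → ZMod 2, (∀ k, ∀ g ∈ L, ∀ h ∈ L, χ k (g * h) = χ k g + χ k h) ∧
      ∀ k j, χ k (b j) = if k = j then 1 else 0 := by
  classical
  refine ⟨fun k g => if h : g ∈ L then
    (b.lift (fun j => Multiplicative.ofAdd (if k = j then (1 : ZMod 2) else 0)) ⟨g, h⟩).toAdd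
    else 0, ?_, ?_⟩
  · intro k g hg h hh
    simp only [hg, hh, L.mul_mem hg hh, dite_true]
    rw [← toAdd_mul, ← _root_.map_mul]
    rfl
  · intro k j
    simp

theorem exists_character_of_ne_bot {ι : Type*} {L : Subgroup (FreeGroup ι)} (hL : L ≠ ⊥) :
    ∃ χ : FreeGroup ι → ZMod 2, (∀ g ∈ L, ∀ h ∈ L, χ (g * h) = χ g + χ h) ∧
      ∃ x ∈ L, χ x = 1 := by
  classical
  obtain ⟨χ, h1, h2⟩ := exists_dual_characters (IsFreeGroup.basis L)
  by_cases hne : Nonempty (IsFreeGroup.Generators L)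
  · obtain ⟨k⟩ := hne
    exact ⟨χ k, h1 k, _, (IsFreeGroup.basis L k).2, by simp [h2]⟩
  · exfalso
    rw [not_nonempty_iff] at hne
    apply hL
    have : Subsingleton L := (IsFreeGroup.toFreeGroup L).toEquiv.subsingleton
    exact (Subgroup.eq_bot_iff_forall _).2 fun g hg =>
      congrArg Subtype.val (Subsingleton.elim (⟨g, hg⟩ : L) 1)

end FreeGroup

namespace IsArcFreeAction

open FreeGroup

variable {ι P : Type*} [MulAction (FreeGroup ι) P] {B : P → P → P → Prop}

open Classical in
/-- The index inequality for actions of free groups on median pretrees in which stabilizers of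
arcs are trivial. -/
theorem sum_two_mul_add_two_le [Fintype ι] (hA : IsArcFreeAction (FreeGroup ι) B)
    (hfix : ∀ p : P, ∃ i : ι, of i • p ≠ p) (pts : Finset P) (hne : pts.Nonempty)
    (horb : ∀ p ∈ pts, ∀ q ∈ pts, ∀ g : FreeGroup ι, g • p = q → p = q)
    (r : P → ℕ) (hr : ∀ p ∈ pts, 1 ≤ r p)
    (x : ∀ p, Fin (r p) → FreeGroup ι) (hx : ∀ p ∈ pts, ∀ a, x p a • p = p)
    (χ : ∀ p, Fin (r p) → FreeGroup ι → ZMod 2)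
    (hχ : ∀ p ∈ pts, ∀ a (g h : FreeGroup ι), g • p = p → h • p = p →
      χ p a (g * h) = χ p a g + χ p a h)
    (hχx : ∀ p ∈ pts, ∀ a a', χ p a (x p a') = if a = a' then 1 else 0) :
    ∑ p ∈ pts, 2 * r p + 2 ≤ 2 * Fintype.card ι + pts.card := by
  obtain ⟨R, hR1, hR⟩ : ∃ R, 1 ≤ R ∧ ∀ p ∈ pts, ∀ a, (x p a).norm ≤ R := by
    refine ⟨1 + ∑ p ∈ pts, ∑ a, (x p a).norm, by omega, fun p hp a => ?_⟩
    have h1 := Finset.single_le_sum (f := fun p => ∑ a, (x p a).norm) (fun _ _ => Nat.zero_le _) hp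
    have h2 := Finset.single_le_sum (f := fun a => (x p a).norm) (fun _ _ => Nat.zero_le _)
      (Finset.mem_univ a)
    omega
  have hSfin : {q : P | ∃ p ∈ pts, ∃ l : List (ι × Bool), l.length ≤ R ∧
      FreeGroup.mk l • p = q}.Finite := by
    have h1 := (List.finite_length_le (ι × Bool) R)
    refine ((pts.finite_toSet.prod h1).image fun s => FreeGroup.mk s.2 • s.1).subset ?_
    rintro q ⟨p, hp, l, hl, rfl⟩
    exact ⟨(p, l), ⟨hp, hl⟩, rfl⟩
  obtain ⟨o, ho⟩ := hne
  obtain ⟨V, hSV, hVm, hVint⟩ := hA.exists_medianClosed hSfin.toFinset o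
  have hSV' : ∀ p ∈ pts, ∀ l : List (ι × Bool), l.length ≤ R → FreeGroup.mk l • p ∈ V :=
    fun p hp l hl => hSV (hSfin.mem_toFinset.2 ⟨p, hp, l, hl, rfl⟩)
  have hpV : ∀ p ∈ pts, p ∈ V := fun p hp => by
    simpa [← FreeGroup.one_eq_mk] using hSV' p hp [] (by simp)
  have hwalk : ∀ p ∈ pts, ∀ l : List (ι × Bool), l.length ≤ R → WalkIn V p (FreeGroup.mk l) := by
    intro p hp l
    induction l with
    | nil => intro _; exact WalkIn.one
    | cons c l ih =>
      intro hl
      have hm := hSV' p hp _ hl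
      have hw := ih (by simp at hl; omega)
      obtain ⟨i, _ | _⟩ := c
      · have e : FreeGroup.mk ((i, false) :: l) = (of i)⁻¹ * FreeGroup.mk l := by
          simp [of, FreeGroup.inv_mk, FreeGroup.mul_mk, FreeGroup.invRev]
        rw [e] at hm ⊢
        exact WalkIn.inv i _ hw (by rwa [mul_smul] at hm)
      · have e : FreeGroup.mk ((i, true) :: l) = of i * FreeGroup.mk l := by
          simp [of, FreeGroup.mul_mk]
        rw [e] at hm ⊢
        exact WalkIn.mul i _ hw (by rwa [mul_smul] at hm)
  have hVne : V.Nonempty := ⟨o, hpV o ho⟩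
  have hVine : ∀ i : ι, (partialDomain V i).Nonempty := by
    intro i
    exact ⟨o, mem_partialDomain.2 ⟨hpV o ho, by simpa [of] using hSV' o ho [(i, true)] (by simpa)⟩⟩
  have hVim : ∀ i : ι, IsMedianPretree.MedianClosed B (partialDomain V i) := by
    intro i a ha b hb c hc m h1 h2 h3
    rw [mem_partialDomain] at *
    exact ⟨hVm a ha.1 b hb.1 c hc.1 m h1 h2 h3,
      hVm _ ha.2 _ hb.2 _ hc.2 _ (hA.smul _ h1) (hA.smul _ h2) (hA.smul _ h3)⟩
  have hVtwo : ∀ y : P, ∃ z ∈ V, z ≠ y := by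
    intro y
    obtain ⟨i, hi⟩ := hfix o
    by_cases h : o = y
    · exact ⟨of i • o, by simpa [of] using hSV' o ho [(i, true)] (by simpa), h ▸ hi⟩
    · exact ⟨o, hpV o ho, h⟩
  -- data on each component
  have hdata : ∀ C : Quotient (walkSetoid ι V), ∃ y : V, Quotient.mk _ y = C ∧
      (∀ p ∈ pts, ∀ hp : p ∈ V, Quotient.mk _ ⟨p, hp⟩ = C → y.1 = p) ∧
      ∃ s : ℕ, (y.1 ∈ pts → s = r y.1) ∧ ∃ (ψ : Fin s → FreeGroup ι → ZMod 2)
        (w : Fin s → FreeGroup ι),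
        (∀ a, ∀ g ∈ loopsIn V y.2, ∀ h ∈ loopsIn V y.2, ψ a (g * h) = ψ a g + ψ a h) ∧
        (∀ a, w a ∈ loopsIn V y.2) ∧ (∀ a a', ψ a (w a') = if a = a' then 1 else 0) ∧
        (s = 0 → y.1 ∉ pts ∧ ∀ g : FreeGroup ι, g ∈ loopsIn V y.2 → g = 1) := by
    intro C
    by_cases hC : ∃ p ∈ pts, ∃ hp : p ∈ V, Quotient.mk (walkSetoid ι V) ⟨p, hp⟩ = C
    · obtain ⟨p, hp, hpv, rfl⟩ := hC
      refine ⟨⟨p, hpv⟩, rfl, ?_, r p, fun _ => rfl, χ p, x p, ?_, ?_, hχx p hp, ?_⟩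
      · intro q hq hqv h
        obtain ⟨g, hg, h'⟩ := Quotient.exact h.symm
        exact horb p hp q hq g h'
      · intro a g hg h hh
        exact hχ p hp a g h hg.2 hh.2
      · intro a
        refine ⟨?_, hx p hp a⟩
        rw [← FreeGroup.mk_toWord (x := x p a)]
        exact hwalk p hp _ (hR p hp a)
      · intro h0
        have := hr p hp
        omega
    · have hCout := Quotient.out_eq C
      set y := Quotient.out C
      have hyp : y.1 ∉ pts := fun h => hC ⟨y.1, h, y.2, hCout⟩
      have hpts : ∀ p ∈ pts, ∀ hp : p ∈ V, Quotient.mk (walkSetoid ι V) ⟨p, hp⟩ = C → y.1 = p :=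
        fun p hp hpv h => absurd ⟨p, hp, hpv, h⟩ hC
      by_cases hL : loopsIn (ι := ι) V y.2 = ⊥
      · refine ⟨y, hCout, hpts, 0, fun h => absurd h hyp, fun a => a.elim0, fun a => a.elim0,
          fun a => a.elim0, fun a => a.elim0, fun a => a.elim0, fun _ => ⟨hyp, fun g hg => ?_⟩⟩
        rwa [hL, Subgroup.mem_bot] at hg
      · obtain ⟨ψ, h1, w, hw, h2⟩ := exists_character_of_ne_bot hL
        refine ⟨y, hCout, hpts, 1, fun h => absurd h hyp, fun _ => ψ, fun _ => w,
          fun _ => h1, fun _ => hw, fun a a' => ?_, fun h => absurd h one_ne_zero⟩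
        simp [h2, Subsingleton.elim a a']
  choose b hb hbp s hsr ψ w hψ hw hψw hs0 using hdata
  let T : Finset (Quotient (walkSetoid ι V)) := Finset.univ.filter fun C => s C = 0
  have hT : ∀ C, C ∈ T ↔ s C = 0 := by simp [T]
  have c1 := card_add_sum_le_sum_partialDomain V b hb s ψ hψ w hw hψw
  have c2 := hA.sum_card_dirs_partialDomain_le V b hb (fun C => hVtwo _) T
    (fun C hC g hg => (hs0 C ((hT C).1 hC)).2 g hg) (by
      intro C hC
      have hnot : (b C).1 ∉ hSfin.toFinset := by
        intro hmem
        obtain ⟨p, hp, l, hl, hpl⟩ := hSfin.mem_toFinset.1 hmem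
        have : Quotient.mk (walkSetoid ι V) ⟨p, hpV p hp⟩ = C := by
          rw [← hb C]
          exact Quotient.sound (s := walkSetoid ι V) ⟨_, hwalk p hp l hl, hpl⟩
        have h' := hbp C p hp _ this
        exact (hs0 C ((hT C).1 hC)).1 (h' ▸ hp)
      obtain ⟨y, hy, z, hz, h⟩ := hVint _ (b C).2 hnot
      exact ⟨y, hy, z, hz, h⟩)
  have c3 := hA.card_dirs hVm hVne
  have c4 := fun i => hA.card_dirs (hVim i) (hVine i)
  have c5 : ∑ i : ι, (hA.dirs (partialDomain V i)).card + 2 * Fintype.card ι =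
      2 * ∑ i : ι, (partialDomain V i).card := by
    rw [Finset.mul_sum, ← Finset.sum_congr rfl (fun i _ => c4 i), Finset.sum_add_distrib]
    simp [mul_comm]
  let cls : P → Quotient (walkSetoid ι V) := fun p =>
    if h : p ∈ V then Quotient.mk _ ⟨p, h⟩ else Quotient.mk _ ⟨o, hpV o ho⟩
  have hcls : ∀ p ∈ pts, (b (cls p)).1 = p := by
    intro p hp
    refine hbp _ p hp (hpV p hp) ?_
    simp [cls, hpV p hp]
  have hclsinj : Set.InjOn cls pts := by
    intro p hp q hq h
    rw [← hcls p hp, h, hcls q hq]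
  have c6 : ∑ p ∈ pts, 2 * r p + Fintype.card (Quotient (walkSetoid ι V)) ≤
      ∑ C, 2 * s C + T.card + pts.card := by
    have e1 : ∑ C ∈ pts.image cls, 2 * s C = ∑ p ∈ pts, 2 * r p := by
      rw [Finset.sum_image hclsinj]
      refine Finset.sum_congr rfl fun p hp => ?_
      rw [hsr (cls p) (by rw [hcls p hp]; exact hp), hcls p hp]
    have e2 : (pts.image cls).card = pts.card := Finset.card_image_of_injOn hclsinj
    have e3 := Finset.sum_add_sum_compl (pts.image cls) fun C => 2 * s C
    have e4 := Finset.card_add_card_compl (pts.image cls)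
    have e5 : (pts.image cls)ᶜ.card ≤ ∑ C ∈ (pts.image cls)ᶜ, 2 * s C + T.card := by
      have : T.card ≥ ((pts.image cls)ᶜ.filter fun C => s C = 0).card :=
        Finset.card_le_card (by
          intro C hC
          simp only [Finset.mem_filter] at hC
          exact (hT C).2 hC.2)
      have h2 : (pts.image cls)ᶜ.card ≤
          ∑ C ∈ (pts.image cls)ᶜ, (2 * s C + if s C = 0 then 1 else 0) := by
        rw [Finset.card_eq_sum_ones]
        refine Finset.sum_le_sum fun C _ => ?_
        split_ifs <;> omega
      rw [Finset.sum_add_distrib, ← Finset.card_filter] at h2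
      omega
    omega
  have c7 : ∑ C, 2 * s C = 2 * ∑ C, s C := (Finset.mul_sum _ _ _).symm
  rw [c7] at c6
  omega

end IsArcFreeAction

namespace FreeGroup

section Cyclic

variable {α : Type*} [DecidableEq α]

theorem exists_cyclic_decomposition (x : FreeGroup α) :
    ∃ u c : FreeGroup α, x = u * c * u⁻¹ ∧ x.norm = 2 * u.norm + c.norm ∧
      (∀ j : ℕ, 1 ≤ j → (x ^ j).norm = 2 * u.norm + j * c.norm) ∧
      ∀ g : FreeGroup α, c.norm ≤ (g * x * g⁻¹).norm := by
  have hr : IsReduced x.toWord := isReduced_toWord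
  have hconj := reduceCyclically.conj_conjugator_reduceCyclically x.toWord
  set a := reduceCyclically.conjugator x.toWord
  set b := reduceCyclically x.toWord
  have ha : IsReduced a := isReduced_of_isInfix hr ⟨[], b ++ invRev a, by simpa using hconj⟩
  have hb : IsReduced b := isReduced_of_isInfix hr ⟨a, invRev a, by simpa using hconj⟩
  have hpow : ∀ j : ℕ, 1 ≤ j → (x ^ j).norm = 2 * (mk a).norm + j * (mk b).norm := by
    intro j hj
    rw [norm_mk_of_isReduced ha, norm_mk_of_isReduced hb, norm, toWord_pow,
      reduceCyclically.reduce_flatten_replicate hr, if_neg (by omega)]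
    simp [a, b]
    ring
  refine ⟨mk a, mk b, ?_, ?_, hpow, ?_⟩
  · rw [inv_mk, mul_mk, mul_mk, hconj, mk_toWord]
  · simpa using hpow 1 le_rfl
  · intro g
    have h1 : ∀ j : ℕ, 1 ≤ j → 2 * (mk a).norm + j * (mk b).norm ≤
        2 * g.norm + j * (g * x * g⁻¹).norm := by
      intro j hj
      rw [← hpow j hj]
      have e : x ^ j = g⁻¹ * (g * x * g⁻¹) ^ j * g := by
        rw [conj_pow]; group
      rw [e]
      have e1 := norm_mul_le (g⁻¹ * (g * x * g⁻¹) ^ j) g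
      have e2 := norm_mul_le g⁻¹ ((g * x * g⁻¹) ^ j)
      rw [norm_inv_eq] at e2
      have e3 : ∀ k : ℕ, ((g * x * g⁻¹) ^ k).norm ≤ k * (g * x * g⁻¹).norm := by
        intro k
        induction k with
        | zero => simp
        | succ k ih =>
          rw [pow_succ]
          have := norm_mul_le ((g * x * g⁻¹) ^ k) (g * x * g⁻¹)
          rw [Nat.succ_mul]
          omega
      have := e3 j
      omega
    by_contra hlt
    push Not at hlt
    have h2 := h1 (2 * g.norm + 1) (by omega)
    nlinarith

theorem le_norm_pow {x : FreeGroup α} (hx : x ≠ 1) (j : ℕ) : j ≤ (x ^ j).norm := by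
  rcases Nat.eq_zero_or_pos j with rfl | hj
  · simp
  obtain ⟨u, c, h1, -, h2, -⟩ := exists_cyclic_decomposition x
  have hc : 1 ≤ c.norm := by
    rw [Nat.one_le_iff_ne_zero, Ne, norm_eq_zero]
    rintro rfl
    simp at h1
    exact hx h1
  rw [h2 j hj]
  nlinarith

end Cyclic

section CyclicLength

variable {n : ℕ}

theorem exists_norm_conj_eq_cyclicLength (y : FreeGroup (Fin n)) :
    ∃ g, (g * y * g⁻¹).norm = cyclicLength y :=
  Nat.sInf_mem (s := {m | ∃ g : FreeGroup (Fin n), FreeGroup.norm (g * y * g⁻¹) = m}) ⟨_, 1, rfl⟩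

theorem cyclicLength_le_norm_conj (g y : FreeGroup (Fin n)) :
    cyclicLength y ≤ (g * y * g⁻¹).norm :=
  Nat.sInf_le ⟨g, rfl⟩

theorem cyclicLength_conj (g y : FreeGroup (Fin n)) :
    cyclicLength (g * y * g⁻¹) = cyclicLength y := by
  apply le_antisymm
  · obtain ⟨h, hh⟩ := exists_norm_conj_eq_cyclicLength y
    rw [← hh]
    have := cyclicLength_le_norm_conj (h * g⁻¹) (g * y * g⁻¹)
    simpa [mul_assoc] using this
  · obtain ⟨h, hh⟩ := exists_norm_conj_eq_cyclicLength (g * y * g⁻¹)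
    rw [← hh]
    have := cyclicLength_le_norm_conj (h * g) y
    simpa [mul_assoc] using this

theorem one_le_cyclicLength {y : FreeGroup (Fin n)} (hy : y ≠ 1) : 1 ≤ cyclicLength y := by
  obtain ⟨h, hh⟩ := exists_norm_conj_eq_cyclicLength y
  rw [← hh, Nat.one_le_iff_ne_zero, Ne, norm_eq_zero, conj_eq_one_iff]
  exact hy

theorem exists_cyclicLength_decomposition (x : FreeGroup (Fin n)) :
    ∃ u c : FreeGroup (Fin n), x = u * c * u⁻¹ ∧ x.norm = 2 * u.norm + c.norm ∧
      c.norm = cyclicLength x ∧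
      ∀ j : ℕ, 1 ≤ j → (x ^ j).norm = 2 * u.norm + j * c.norm := by
  obtain ⟨u, c, h1, h2, h3, h4⟩ := exists_cyclic_decomposition x
  refine ⟨u, c, h1, h2, le_antisymm ?_ ?_, h3⟩
  · obtain ⟨g, hg⟩ := exists_norm_conj_eq_cyclicLength x
    exact hg ▸ h4 g
  · have := cyclicLength_le_norm_conj u⁻¹ x
    rw [h1] at this
    rw [h1]
    simpa [mul_assoc] using this

end CyclicLength

section Lipschitz

variable {α β : Type*} [DecidableEq α] [DecidableEq β]

theorem norm_map_le (φ : FreeGroup α →* FreeGroup β) {L : ℕ} (hL : ∀ i, (φ (of i)).norm ≤ L)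
    (x : FreeGroup α) : (φ x).norm ≤ L * x.norm := by
  have key : ∀ l : List (α × Bool), (φ (mk l)).norm ≤ L * l.length := by
    intro l
    induction l with
    | nil => simp [← one_eq_mk]
    | cons c l ih =>
      have h : (φ (mk [c])).norm ≤ L := by
        obtain ⟨i, _ | _⟩ := c
        · have e : (mk [(i, false)] : FreeGroup α) = (of i)⁻¹ := rfl
          rw [e, _root_.map_inv, norm_inv_eq]
          exact hL i
        · exact hL i
      have e : (mk (c :: l) : FreeGroup α) = mk [c] * mk l := by rw [mul_mk]; rfl
      rw [e, _root_.map_mul, List.length_cons]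
      have := norm_mul_le (φ (mk [c])) (φ (mk l))
      rw [Nat.mul_succ]
      omega
  have := key x.toWord
  rwa [mk_toWord] at this

theorem exists_lipschitz [Finite α] (φ : FreeGroup α →* FreeGroup β) :
    ∃ L : ℕ, 1 ≤ L ∧ ∀ x, (φ x).norm ≤ L * x.norm := by
  have := Fintype.ofFinite α
  refine ⟨1 + ∑ i, (φ (of i)).norm, by omega, norm_map_le φ fun i => ?_⟩
  have := Finset.single_le_sum (f := fun i => (φ (of i)).norm) (fun _ _ => Nat.zero_le _)
    (Finset.mem_univ i)
  omega

theorem exists_treeDist_lipschitz [Finite α] (φ : FreeGroup α →* FreeGroup β) :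
    ∃ L : ℤ, 1 ≤ L ∧ ∀ u v, treeDist (φ u) (φ v) ≤ L * treeDist u v := by
  obtain ⟨L, h1, hL⟩ := exists_lipschitz φ
  refine ⟨L, by exact_mod_cast h1, fun u v => ?_⟩
  unfold treeDist
  rw [← _root_.map_inv, ← _root_.map_mul]
  exact_mod_cast hL _

end Lipschitz

section BoundedCancellation

variable {α β : Type*} [DecidableEq α] [DecidableEq β]

theorem gromovProd_convex {u v p q w : FreeGroup α} (hp : gromovProd u v p = 0)
    (hq : gromovProd u v q = 0) (hw : gromovProd p q w = 0) : gromovProd u v w = 0 := by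
  have a1 := gromovProd_nonneg u v w
  have a2 := gromovProd_four_point p u q w
  have a3 := gromovProd_four_point u p v w
  have a4 := gromovProd_four_point u v q w
  have a5 := gromovProd_four_point u q v w
  have := treeDist_comm p u
  have := treeDist_comm p v
  have := treeDist_comm q u
  have := treeDist_comm q v
  have := gromovProd_nonneg u p w
  have := gromovProd_nonneg u q w
  have := gromovProd_nonneg v p w
  have := gromovProd_nonneg v q w
  have := treeDist_triangle u w v
  have := treeDist_comm u w
  have := treeDist_comm v w
  have := treeDist_nonneg p w
  have := treeDist_comm p w
  have := treeDist_comm q w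
  have := treeDist_nonneg q w
  have := treeDist_comm v u
  have := gromovProd_four_point u v p w
  unfold gromovProd at *
  omega

theorem exists_near_of_gromovProd_eq_zero (φ : FreeGroup α →* FreeGroup β) {L : ℤ} (hL0 : 0 ≤ L)
    (hL : ∀ u v, treeDist (φ u) (φ v) ≤ L * treeDist u v) (w u : FreeGroup α) (z : FreeGroup β)
    (hz : gromovProd (φ w) (φ u) z = 0) :
    ∃ u', gromovProd w u u' = 0 ∧ treeDist (φ u') z ≤ L := by
  obtain ⟨d, hd⟩ := Int.eq_ofNat_of_zero_le (treeDist_nonneg w u)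
  induction d generalizing u with
  | zero =>
    rw [Nat.cast_zero, treeDist_eq_zero] at hd
    subst hd
    refine ⟨w, ?_, ?_⟩
    · simp [gromovProd, treeDist_self]
    · have := treeDist_comm (φ w) z
      have := treeDist_self (φ w)
      unfold gromovProd at hz
      omega
  | succ d ih =>
    obtain ⟨u₁, h1, h2⟩ := exists_between w u d (by omega) (by rw [hd]; push_cast; omega)
    have h3 : treeDist u₁ u = 1 := by
      have := treeDist_comm u₁ w
      unfold gromovProd at h1
      push_cast at hd
      omega
    by_cases h4 : gromovProd (φ w) (φ u₁) z = 0
    · obtain ⟨u', h5, h6⟩ := ih u₁ h4 h2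
      refine ⟨u', ?_, h6⟩
      have := treeDist_triangle u' u₁ u
      have := gromovProd_nonneg w u u'
      have := treeDist_comm u₁ w
      unfold gromovProd at *
      omega
    · refine ⟨u, ?_, ?_⟩
      · simp [gromovProd, treeDist_self, treeDist_comm]
      · have h5 := gromovProd_four_point (φ w) (φ u₁) (φ u) z
        have := gromovProd_nonneg (φ w) (φ u₁) z
        have h6 : gromovProd (φ u₁) (φ u) z ≤ 0 := by omega
        have h7 := hL u₁ u
        rw [h3, mul_one] at h7
        have := treeDist_comm (φ u) z
        have := treeDist_nonneg z (φ u₁)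
        unfold gromovProd at h6
        omega

/-- Bounded cancellation. -/
theorem exists_bounded_cancellation [Finite α] [Finite β] (e : FreeGroup α ≃* FreeGroup β) :
    ∃ L C : ℤ, 1 ≤ L ∧ 0 ≤ C ∧ (∀ u v, treeDist (e u) (e v) ≤ L * treeDist u v) ∧
      ∀ u v w, gromovProd (e u) (e v) (e w) ≤ L * gromovProd u v w + C := by
  obtain ⟨L, hL1, hL⟩ := exists_treeDist_lipschitz e.toMonoidHom
  obtain ⟨K, hK1, hK⟩ := exists_treeDist_lipschitz e.symm.toMonoidHom
  have hL' : ∀ u v, treeDist (e u) (e v) ≤ L * treeDist u v := hL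
  have hK' : ∀ u v, treeDist u v ≤ K * treeDist (e u) (e v) := fun u v => by
    simpa using hK (e u) (e v)
  have hC : ∀ u v w, gromovProd u v w = 0 →
      gromovProd (e u) (e v) (e w) ≤ 2 * (L + L * (K * (2 * L))) := by
    intro u v w h
    obtain ⟨z, z1, z2, z3⟩ := exists_median (e w) (e u) (e v)
    obtain ⟨u', hu, hu'⟩ := exists_near_of_gromovProd_eq_zero e.toMonoidHom (by omega) hL w u z z1
    obtain ⟨v', hv, hv'⟩ := exists_near_of_gromovProd_eq_zero e.toMonoidHom (by omega) hL w v z z2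
    change treeDist (e u') z ≤ L at hu'
    change treeDist (e v') z ≤ L at hv'
    have b1 : treeDist (e u') (e v') ≤ 2 * L := by
      have := treeDist_triangle (e u') z (e v')
      have := treeDist_comm z (e v')
      omega
    have b2 : treeDist u' v' ≤ K * (2 * L) :=
      (hK' _ _).trans (mul_le_mul_of_nonneg_left b1 (by omega))
    have b3 : treeDist w u' ≤ K * (2 * L) := by
      have := treeDist_triangle u u' v'
      have := treeDist_triangle u v' v
      have := treeDist_nonneg w v'
      have := treeDist_comm u u'
      have := treeDist_comm w u'
      have := treeDist_comm w v'
      unfold gromovProd at h hu hv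
      omega
    have b4 : treeDist (e w) (e u') ≤ L * (K * (2 * L)) :=
      (hL' _ _).trans (mul_le_mul_of_nonneg_left b3 (by omega))
    have := treeDist_triangle (e w) (e u') z
    have := treeDist_comm z (e w)
    unfold gromovProd at *
    omega
  refine ⟨L, 2 * (L + L * (K * (2 * L))), hL1, by positivity, hL', fun u v w => ?_⟩
  obtain ⟨m, m1, m2, m3⟩ := exists_median u v w
  have h1 := hC u v m m1
  have h2 := hL' w m
  have h3 : gromovProd u v w = 2 * treeDist w m := by
    have := treeDist_comm w m
    have := treeDist_comm w u
    have := treeDist_comm w v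
    have := treeDist_comm m u
    have := treeDist_comm m v
    unfold gromovProd at *
    omega
  rw [h3]
  have := treeDist_triangle (e w) (e m) (e u)
  have := treeDist_triangle (e w) (e m) (e v)
  unfold gromovProd at h1 ⊢
  linarith

end BoundedCancellation

end FreeGroup

namespace FreeGroup

section Periods

variable {α β : Type*} [DecidableEq α] [DecidableEq β]

theorem treeDist_pow_mul (c v : FreeGroup α) (i j : ℕ) :
    treeDist (c ^ i * v) (c ^ (i + j) * v) = ((v⁻¹ * c * v) ^ j).norm := by
  unfold treeDist
  have : (v⁻¹ * c * v) ^ j = v⁻¹ * c ^ j * v := by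
    simpa using (conj_pow (i := j) (a := v⁻¹) (b := c))
  rw [this, pow_add]
  congr 2
  group

theorem exists_periodic_image [Finite α] [Finite β] (e : FreeGroup α ≃* FreeGroup β) :
    ∃ E : ℕ, ∀ (c u u' w : FreeGroup α) (m : ℕ), c ≠ 1 →
      (∀ j ≤ m, gromovProd u u' (c ^ j * w) = 0) →
      ∃ w', ∀ j, j + E ≤ m → gromovProd (e u) (e u') (e c ^ j * w') = 0 := by
  obtain ⟨L, C, hL, hC, -, hLC⟩ := exists_bounded_cancellation e
  obtain ⟨J, hJ⟩ := Int.eq_ofNat_of_zero_le (show 0 ≤ C + 1 by omega)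
  refine ⟨2 * J, fun c u u' w m hc hw => ?_⟩
  set v := e w
  have hh : v⁻¹ * e c * v ≠ 1 := by
    intro h
    have h2 : e c = 1 := by simpa using (conj_eq_one_iff (a := v⁻¹) (b := e c)).1 (by simpa using h)
    exact hc (by simpa using h2)
  have hN := le_norm_pow hh (2 * J)
  have d1 := treeDist_pow_mul (e c) v 0 J
  have d2 := treeDist_pow_mul (e c) v J J
  have d3 := treeDist_pow_mul (e c) v 0 (2 * J)
  rw [pow_zero, one_mul, zero_add] at d1 d3
  rw [← two_mul] at d2
  obtain ⟨w', m1, m2, m3⟩ := exists_median v (e c ^ J * v) (e c ^ (2 * J) * v)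
  refine ⟨w', fun j hj => ?_⟩
  have near : ∀ i ≤ m, ∃ p, gromovProd (e u) (e u') p = 0 ∧
      2 * treeDist (e c ^ i * v) p ≤ C := by
    intro i hi
    have h1 := hLC u u' (c ^ i * w)
    rw [hw i hi, mul_zero, zero_add, _root_.map_mul, map_pow] at h1
    change gromovProd (e u) (e u') (e c ^ i * v) ≤ C at h1
    obtain ⟨p, p1, p2, p3⟩ := exists_median (e u) (e u') (e c ^ i * v)
    refine ⟨p, p1, ?_⟩
    have := treeDist_comm (e c ^ i * v) (e u)
    have := treeDist_comm (e c ^ i * v) (e u')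
    have := treeDist_comm (e c ^ i * v) p
    have := treeDist_comm p (e u)
    have := treeDist_comm p (e u')
    unfold gromovProd at *
    omega
  obtain ⟨p, p1, p2⟩ := near j (by omega)
  obtain ⟨q, q1, q2⟩ := near (j + 2 * J) hj
  have hm : gromovProd (e c ^ j * v) (e c ^ (j + 2 * J) * v) (e c ^ j * w') = 0 := by
    rw [pow_add, mul_assoc, gromovProd_mul_left]
    exact m2
  have t1 : 2 * treeDist w' v = ((v⁻¹ * e c * v) ^ (2 * J)).norm ∧
      2 * treeDist w' (e c ^ (2 * J) * v) = ((v⁻¹ * e c * v) ^ (2 * J)).norm := by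
    have := treeDist_comm w' v
    have := treeDist_comm w' (e c ^ J * v)
    have := treeDist_comm w' (e c ^ (2 * J) * v)
    have := treeDist_comm v (e c ^ J * v)
    unfold gromovProd at m1 m2 m3
    omega
  refine gromovProd_convex p1 q1 (gromovProd_eq_zero_of_near hm ?_ ?_)
  · rw [treeDist_mul_left]
    omega
  · rw [pow_add (e c) j (2 * J), mul_assoc (e c ^ j), treeDist_mul_left, ← mul_assoc, ← pow_add]
    omega

theorem exists_period_bound [Finite α] (e : FreeGroup α ≃* FreeGroup α) :
    ∃ E : ℕ, ∀ (x y y' w : FreeGroup α) (k m : ℕ), x ≠ 1 →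
      (∀ j ≤ m, gromovProd ((e ^ k) y) ((e ^ k) y') ((e ^ k) x ^ j * w) = 0) →
      (m : ℤ) ≤ treeDist y y' + E * k := by
  obtain ⟨E, hE⟩ := exists_periodic_image e.symm
  refine ⟨E, fun x y y' w k => ?_⟩
  induction k generalizing w with
  | zero =>
    intro m hx h
    have hh : w⁻¹ * x * w ≠ 1 := by
      intro h
      exact hx (by simpa using (conj_eq_one_iff (a := w⁻¹) (b := x)).1 (by simpa using h))
    have h1 := le_norm_pow hh m
    have h2 := treeDist_pow_mul x w 0 m
    have h3 := h 0 (by omega)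
    have h4 := h m le_rfl
    simp only [pow_zero, MulAut.one_apply, one_mul, zero_add] at h2 h3 h4
    have := treeDist_triangle y w y'
    have := treeDist_triangle y (x ^ m * w) y'
    have := treeDist_triangle w y (x ^ m * w)
    have := treeDist_triangle w y' (x ^ m * w)
    have := treeDist_comm y w
    have := treeDist_comm y' w
    have := treeDist_comm y (x ^ m * w)
    have := treeDist_comm y' (x ^ m * w)
    unfold gromovProd at h3 h4
    push_cast
    omega
  | succ k ih =>
    intro m hx h
    have hs : ∀ z, e.symm ((e ^ (k + 1)) z) = (e ^ k) z := by
      intro z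
      rw [pow_succ']
      simp
    have hx' : (e ^ (k + 1)) x ≠ 1 := by simpa using hx
    obtain ⟨w', hw'⟩ := hE _ _ _ w m hx' h
    rw [hs, hs, hs] at hw'
    rcases le_or_gt E m with hm | hm
    · have := ih w' (m - E) hx fun j hj => hw' j (by omega)
      push_cast [hm] at this ⊢
      linarith
    · have := treeDist_nonneg y y'
      push_cast
      have : (0 : ℤ) ≤ E * k := by positivity
      linarith

end Periods

end FreeGroup

/-- An ultrafilter at infinity together with a positive exponential rate. -/
structure LimitScale where
  toUltrafilter : Ultrafilter ℕ
  le_atTop : (toUltrafilter : Filter ℕ) ≤ Filter.atTop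
  rate : ℝ
  rate_pos : 0 < rate

namespace LimitScale

variable (s : LimitScale)

/-- A sequence is slow if it grows at a strictly smaller exponential rate along the ultrafilter. -/
def IsSlow (r : ℕ → ℤ) : Prop :=
  ∃ δ : ℝ, 0 < δ ∧ ∀ᶠ k in (s.toUltrafilter : Filter ℕ), (r k : ℝ) ≤ Real.exp ((s.rate - δ) * k)

variable {s}

theorem eventually_mul_exp_le {δ : ℝ} (hδ : 0 < δ) (c : ℝ) :
    ∀ᶠ k : ℕ in (s.toUltrafilter : Filter ℕ),
      c * (k + 1) * Real.exp ((s.rate - δ) * k) ≤ Real.exp ((s.rate - δ / 2) * k) := by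
  obtain ⟨N, hN⟩ := exists_nat_ge (16 * |c| / δ ^ 2)
  filter_upwards [s.le_atTop (Filter.eventually_ge_atTop (max N 1))] with k hk
  have h1 : (1 : ℝ) ≤ k := by exact_mod_cast (le_max_right N 1).trans hk
  have h2 : 16 * |c| ≤ k * δ ^ 2 := by
    have : (N : ℝ) ≤ k := by exact_mod_cast (le_max_left N 1).trans hk
    rw [div_le_iff₀ (by positivity)] at hN
    nlinarith [sq_nonneg δ]
  have h3 := Real.quadratic_le_exp_of_nonneg (show 0 ≤ δ / 2 * k by positivity)
  have h4 : c * (k + 1) ≤ Real.exp (δ / 2 * k) := by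
    have h5 : c * (k + 1) ≤ |c| * (2 * k) := by
      have := le_abs_self c
      have := abs_nonneg c
      nlinarith
    have h6 : 0 ≤ δ / 2 * k := by positivity
    nlinarith
  have h7 : (s.rate - δ / 2) * k = δ / 2 * k + (s.rate - δ) * k := by ring
  rw [h7, Real.exp_add]
  exact mul_le_mul_of_nonneg_right h4 (Real.exp_pos _).le

namespace IsSlow

variable {r t : ℕ → ℤ}

theorem mono (h : s.IsSlow r) (htr : ∀ k, t k ≤ r k) : s.IsSlow t := by
  obtain ⟨δ, hδ, hr⟩ := h
  refine ⟨δ, hδ, hr.mono fun k hk => le_trans ?_ hk⟩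
  exact_mod_cast htr k

theorem const_mul (h : s.IsSlow r) (c : ℕ) : s.IsSlow fun k => c * (k + 1) * r k := by
  obtain ⟨δ, hδ, hr⟩ := h
  refine ⟨δ / 2, by positivity, ?_⟩
  filter_upwards [hr, s.eventually_mul_exp_le hδ c] with k h1 h2
  refine le_trans ?_ h2
  push_cast
  exact mul_le_mul_of_nonneg_left h1 (by positivity)

theorem add (hr : s.IsSlow r) (ht : s.IsSlow t) : s.IsSlow fun k => r k + t k := by
  obtain ⟨δ₁, hδ₁, h₁⟩ := hr
  obtain ⟨δ₂, hδ₂, h₂⟩ := ht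
  have hδ : 0 < min δ₁ δ₂ := lt_min hδ₁ hδ₂
  refine ⟨min δ₁ δ₂ / 2, by positivity, ?_⟩
  filter_upwards [h₁, h₂, s.eventually_mul_exp_le hδ 2] with k h1 h2 h3
  have e1 : Real.exp ((s.rate - δ₁) * k) ≤ Real.exp ((s.rate - min δ₁ δ₂) * k) := by
    gcongr
    exact min_le_left _ _
  have e2 : Real.exp ((s.rate - δ₂) * k) ≤ Real.exp ((s.rate - min δ₁ δ₂) * k) := by
    gcongr
    exact min_le_right _ _
  have e3 := mul_nonneg (Nat.cast_nonneg (α := ℝ) k) (Real.exp_pos ((s.rate - min δ₁ δ₂) * k)).le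
  push_cast
  linarith

theorem const (c : ℤ) : s.IsSlow fun _ => c := by
  have h : s.IsSlow fun _ => 1 := by
    refine ⟨s.rate, s.rate_pos, Filter.Eventually.of_forall fun k => ?_⟩
    simp
  refine (h.const_mul c.natAbs).mono fun k => ?_
  have : c ≤ c.natAbs := by omega
  have : (0 : ℤ) ≤ c.natAbs * k := by positivity
  linarith

theorem or_of_min_le {q : ℕ → ℤ} (h : s.IsSlow q) (hq : ∀ k, min (r k) (t k) ≤ q k) :
    s.IsSlow r ∨ s.IsSlow t := by
  obtain ⟨δ, hδ, hr⟩ := h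
  have : ∀ᶠ k in (s.toUltrafilter : Filter ℕ), r k ≤ q k ∨ t k ≤ q k :=
    Filter.Eventually.of_forall fun k => min_le_iff.1 (hq k)
  rw [Ultrafilter.eventually_or] at this
  refine this.imp (fun h => ⟨δ, hδ, ?_⟩) (fun h => ⟨δ, hδ, ?_⟩)
  all_goals
    filter_upwards [h, hr] with k h1 h2
    refine le_trans ?_ h2
    exact_mod_cast h1

end IsSlow

end LimitScale

namespace FreeGroup

section LimitTree

variable {α : Type*} [DecidableEq α]

theorem gromovProd_le_add (u v g m : FreeGroup α) :
    gromovProd u v m ≤ gromovProd u g m + gromovProd u v g := by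
  have := treeDist_triangle m g v
  have := treeDist_comm u g
  unfold gromovProd
  omega

theorem gromovProd_le_of_treeDist (u v w u' v' w' : FreeGroup α) :
    gromovProd u' v' w' ≤
      gromovProd u v w + (2 * treeDist u u' + 2 * treeDist v v' + 2 * treeDist w w') := by
  have := treeDist_triangle w' w u'
  have := treeDist_triangle w u u'
  have := treeDist_triangle w' w v'
  have := treeDist_triangle w v v'
  have := treeDist_triangle u u' v
  have := treeDist_triangle u' v' v
  have := treeDist_comm w' w
  have := treeDist_comm v' v
  unfold gromovProd
  omega

variable (s : LimitScale) (Φ : FreeGroup α ≃* FreeGroup α)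

/-- Sequences that stay slowly close to the images of a fixed segment under the iterates of `Φ`. -/
def LimitSeq : Type _ :=
  {g : ℕ → FreeGroup α // ∃ y, s.IsSlow fun k => gromovProd 1 ((Φ ^ k) y) (g k)}

variable {s Φ}

theorem LimitSeq.exists_of_isSlow (g h : LimitSeq s Φ) {m : ℕ → FreeGroup α}
    (hm : s.IsSlow fun k => gromovProd (g.1 k) (h.1 k) (m k)) :
    ∃ y, s.IsSlow fun k => gromovProd 1 ((Φ ^ k) y) (m k) := by
  obtain ⟨y, hy⟩ := g.2
  obtain ⟨z, hz⟩ := h.2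
  rcases hm.or_of_min_le fun k => gromovProd_four_point (g.1 k) 1 (h.1 k) (m k) with h1 | h1
  · refine ⟨y, (h1.add hy).mono fun k => ?_⟩
    rw [gromovProd_comm (g.1 k) 1]
    exact gromovProd_le_add _ _ _ _
  · exact ⟨z, (h1.add hz).mono fun k => gromovProd_le_add _ _ _ _⟩

instance : MulAction (FreeGroup α) (LimitSeq s Φ) where
  smul x g := ⟨fun k => (Φ ^ k) x * g.1 k, by
    obtain ⟨y, hy⟩ := g.2
    have h1 : s.IsSlow fun k =>
        gromovProd ((Φ ^ k) x) ((Φ ^ k) (x * y)) ((Φ ^ k) x * g.1 k) := by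
      refine hy.mono fun k => ?_
      rw [_root_.map_mul, ← gromovProd_mul_left ((Φ ^ k) x) 1, mul_one]
    rcases h1.or_of_min_le fun k => gromovProd_four_point _ 1 _ _ with h2 | h2
    · refine ⟨x, h2.mono fun k => (gromovProd_comm _ _ _).le⟩
    · exact ⟨x * y, h2⟩⟩
  one_smul g := Subtype.ext (by funext k; exact (by simp : (Φ ^ k) 1 * g.1 k = g.1 k))
  mul_smul x y g := Subtype.ext (by
    funext k
    exact (by simp [mul_assoc] : (Φ ^ k) (x * y) * g.1 k = (Φ ^ k) x * ((Φ ^ k) y * g.1 k)))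

theorem LimitSeq.smul_apply (x : FreeGroup α) (g : LimitSeq s Φ) (k : ℕ) :
    (x • g).1 k = (Φ ^ k) x * g.1 k := rfl

variable (s Φ)

/-- Sequences at slow distance are identified. -/
def limitSetoid : Setoid (LimitSeq s Φ) where
  r g h := s.IsSlow fun k => treeDist (g.1 k) (h.1 k)
  iseqv :=
    { refl := fun _ => (LimitScale.IsSlow.const 0).mono fun _ => (treeDist_self _).le
      symm := fun h => h.mono fun _ => (treeDist_comm _ _).le
      trans := fun h h' => (h.add h').mono fun _ => treeDist_triangle _ _ _ }

/-- The limit pretree of the iterates of `Φ`. -/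
def LimitTree : Type _ := Quotient (limitSetoid s Φ)

variable {s Φ}

/-- The point of the limit pretree represented by a sequence. -/
def LimitTree.mk (g : LimitSeq s Φ) : LimitTree s Φ := Quotient.mk (limitSetoid s Φ) g

theorem LimitTree.mk_eq_mk {g h : LimitSeq s Φ} :
    LimitTree.mk g = LimitTree.mk h ↔ s.IsSlow fun k => treeDist (g.1 k) (h.1 k) :=
  Quotient.eq (r := limitSetoid s Φ)

theorem LimitTree.exists_rep (p : LimitTree s Φ) : ∃ g, LimitTree.mk g = p :=
  Quotient.exists_rep p

instance : MulAction (FreeGroup α) (LimitTree s Φ) where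
  smul x := Quotient.map (fun g => x • g) fun g h hgh => by
    change s.IsSlow _ at hgh
    exact hgh.mono fun k => (treeDist_mul_left _ _ _).le
  one_smul p := by
    obtain ⟨g, rfl⟩ := p.exists_rep
    exact congrArg LimitTree.mk (one_smul _ g)
  mul_smul x y p := by
    obtain ⟨g, rfl⟩ := p.exists_rep
    exact congrArg LimitTree.mk (mul_smul x y g)

theorem LimitTree.smul_mk (x : FreeGroup α) (g : LimitSeq s Φ) :
    x • LimitTree.mk g = LimitTree.mk (x • g) := rfl

/-- Betweenness in the limit pretree. -/
def LimitTree.Btw (p q t : LimitTree s Φ) : Prop :=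
  ∃ g h m : LimitSeq s Φ, LimitTree.mk g = p ∧ LimitTree.mk m = q ∧ LimitTree.mk h = t ∧
    s.IsSlow fun k => gromovProd (g.1 k) (h.1 k) (m.1 k)

theorem LimitTree.btw_mk {g m h : LimitSeq s Φ} :
    LimitTree.Btw (LimitTree.mk g) (LimitTree.mk m) (LimitTree.mk h) ↔
      s.IsSlow fun k => gromovProd (g.1 k) (h.1 k) (m.1 k) := by
  refine ⟨?_, fun hs => ⟨g, h, m, rfl, rfl, rfl, hs⟩⟩
  rintro ⟨g', h', m', hg, hm, hh, hs⟩
  rw [LimitTree.mk_eq_mk] at hg hm hh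
  refine (hs.add (((hg.add hg).add (hh.add hh)).add (hm.add hm))).mono fun k => ?_
  have := gromovProd_le_of_treeDist (g'.1 k) (h'.1 k) (m'.1 k) (g.1 k) (h.1 k) (m.1 k)
  linarith

theorem LimitTree.isMedianPretree : IsMedianPretree (LimitTree.Btw (s := s) (Φ := Φ)) where
  left p t := by
    obtain ⟨g, rfl⟩ := p.exists_rep
    obtain ⟨h, rfl⟩ := t.exists_rep
    rw [btw_mk]
    refine (LimitScale.IsSlow.const 0).mono fun k => ?_
    simp [gromovProd, treeDist_self]
  symm {p q t} h := by
    obtain ⟨g, rfl⟩ := p.exists_rep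
    obtain ⟨m, rfl⟩ := q.exists_rep
    obtain ⟨h, rfl⟩ := t.exists_rep
    rw [btw_mk] at *
    exact h.mono fun k => (gromovProd_comm _ _ _).le
  sub {p q t} hpt r := by
    obtain ⟨g, rfl⟩ := p.exists_rep
    obtain ⟨m, rfl⟩ := q.exists_rep
    obtain ⟨h, rfl⟩ := t.exists_rep
    obtain ⟨l, rfl⟩ := r.exists_rep
    rw [btw_mk] at *
    rw [btw_mk]
    exact hpt.or_of_min_le fun k => gromovProd_four_point _ _ _ _
  antisymm {p q t} h1 h2 := by
    obtain ⟨g, rfl⟩ := p.exists_rep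
    obtain ⟨m, rfl⟩ := q.exists_rep
    obtain ⟨h, rfl⟩ := t.exists_rep
    rw [btw_mk] at *
    rw [mk_eq_mk]
    refine (h1.add h2).mono fun k => ?_
    have := treeDist_comm (m.1 k) (g.1 k)
    have := treeDist_comm (h.1 k) (g.1 k)
    have := treeDist_comm (m.1 k) (h.1 k)
    have := treeDist_nonneg (m.1 k) (h.1 k)
    unfold gromovProd
    omega
  median p q t := by
    obtain ⟨g, rfl⟩ := p.exists_rep
    obtain ⟨h, rfl⟩ := q.exists_rep
    obtain ⟨l, rfl⟩ := t.exists_rep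
    choose m h1 h2 h3 using fun k => exists_median (g.1 k) (h.1 k) (l.1 k)
    have e : ∀ {r : ℕ → ℤ}, (∀ k, r k = 0) → s.IsSlow r := fun h =>
      (LimitScale.IsSlow.const 0).mono fun k => (h k).le
    refine ⟨mk ⟨m, LimitSeq.exists_of_isSlow g h (e h1)⟩, ?_, ?_, ?_⟩
    · exact btw_mk.2 (e h1)
    · exact btw_mk.2 (e h2)
    · exact btw_mk.2 (e h3)

end LimitTree

end FreeGroup

namespace FreeGroup

theorem apply_pow_comm {α : Type*} (Φ : FreeGroup α ≃* FreeGroup α) (k : ℕ) (y : FreeGroup α) :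
    (Φ ^ k) (Φ y) = Φ ((Φ ^ k) y) := by
  rw [← MulAut.mul_apply, ← MulAut.mul_apply, ← pow_succ, ← pow_succ']

section ArcTrivial

variable {α : Type*} [DecidableEq α]

theorem gromovProd_lt_of_not_period {c g h Y : FreeGroup α} {r : ℤ} {N : ℕ}
    (hg : treeDist g (c * g) ≤ r) (hh : treeDist h (c * h) ≤ r) (hY : gromovProd 1 Y g = 0)
    (hN : ∀ w, (∀ j ≤ N, gromovProd 1 Y (c ^ j * w) = 0) → False) :
    gromovProd 1 h g ≤ 4 * N * r + 3 := by
  by_contra hlt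
  push Not at hlt
  have hr : 0 ≤ r := (treeDist_nonneg _ _).trans hg
  obtain ⟨a, ha⟩ : ∃ a : ℤ, a = gromovProd 1 h g / 4 := ⟨_, rfl⟩
  have ha1 : N * r < a := by
    have : 4 * (N * r) + 3 < gromovProd 1 h g := by linarith
    omega
  have hNr : 0 ≤ N * r := by positivity
  have ha2 : 2 * a ≤ treeDist g h := by
    have := treeDist_triangle 1 h g
    have := treeDist_comm g h
    have := treeDist_comm g 1
    unfold gromovProd at *
    omega
  obtain ⟨w, hw1, hw2⟩ := exists_between g h a (by omega) (by omega)
  have hpow : ∀ (q : FreeGroup α), treeDist q (c * q) ≤ r → ∀ j : ℕ,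
      treeDist q (c ^ j * q) ≤ j * r := by
    intro q hq j
    induction j with
    | zero => simp [treeDist_self]
    | succ j ih =>
      have h1 := treeDist_triangle q (c ^ j * q) (c ^ (j + 1) * q)
      have h2 : treeDist (c ^ j * q) (c ^ (j + 1) * q) ≤ r := by
        rw [pow_succ, mul_assoc, treeDist_mul_left]
        exact hq
      push_cast
      linarith
  refine hN w fun j hj => ?_
  have hjr : (j : ℤ) * r ≤ N * r := by gcongr
  have h1 := hpow g hg j
  have h2 := hpow h hh j
  have h3 : gromovProd (c ^ j * g) (c ^ j * h) (c ^ j * w) = 0 := by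
    rw [gromovProd_mul_left]
    exact hw1
  have e1 : treeDist w g = a := by rw [treeDist_comm, hw2]
  have e2 : a ≤ treeDist w h := by
    unfold gromovProd at hw1
    omega
  have h4 : gromovProd g h (c ^ j * w) = 0 := by
    refine gromovProd_eq_zero_of_near h3 ?_ ?_
    · rw [treeDist_mul_left, treeDist_comm]
      omega
    · rw [treeDist_mul_left, treeDist_comm]
      omega
  have h5 : treeDist g (c ^ j * w) < 2 * a := by
    have := treeDist_triangle g (c ^ j * g) (c ^ j * w)
    rw [treeDist_mul_left] at this
    omega
  have h6 := gromovProd_four_point g 1 h (c ^ j * w)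
  have h7 : 0 < gromovProd 1 h (c ^ j * w) := by
    have := gromovProd_le_of_treeDist 1 h (c ^ j * w) 1 h g
    rw [treeDist_self, treeDist_self, treeDist_comm _ g] at this
    omega
  have h8 := gromovProd_nonneg g 1 (c ^ j * w)
  have h9 := gromovProd_comm g 1 (c ^ j * w)
  have h10 := gromovProd_le_add 1 Y g (c ^ j * w)
  have h11 := gromovProd_nonneg 1 Y (c ^ j * w)
  omega

theorem gromovProd_le_of_not_period {c g h Y : FreeGroup α} {r : ℤ} {N : ℕ}
    (hg : treeDist g (c * g) ≤ r) (hh : treeDist h (c * h) ≤ r)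
    (hN : ∀ w, (∀ j ≤ N, gromovProd 1 Y (c ^ j * w) = 0) → False) :
    gromovProd 1 h g ≤ 4 * N * (r + gromovProd 1 Y g) + 3 + gromovProd 1 Y g := by
  obtain ⟨g', h1, h2, h3⟩ := exists_median 1 Y g
  have e : gromovProd 1 Y g = 2 * treeDist g g' := by
    have := treeDist_comm g g'
    have := treeDist_comm g 1
    have := treeDist_comm g Y
    have := treeDist_comm g' 1
    have := treeDist_comm g' Y
    unfold gromovProd at *
    omega
  have hg' : treeDist g' (c * g') ≤ r + gromovProd 1 Y g := by
    have := treeDist_triangle g' g (c * g')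
    have := treeDist_triangle g (c * g) (c * g')
    rw [treeDist_mul_left] at this
    have := treeDist_comm g g'
    omega
  have := gromovProd_lt_of_not_period hg'
    (hh.trans (by have := gromovProd_nonneg 1 Y g; omega)) h1 hN
  have := gromovProd_le_of_treeDist 1 h g' 1 h g
  rw [treeDist_self, treeDist_self, treeDist_comm g'] at this
  omega

variable {s : LimitScale} {Φ : FreeGroup α ≃* FreeGroup α}

theorem LimitTree.smul_mk_eq_iff {x : FreeGroup α} {g : LimitSeq s Φ} :
    x • LimitTree.mk g = LimitTree.mk g ↔
      s.IsSlow fun k => treeDist (g.1 k) ((Φ ^ k) x * g.1 k) := by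
  rw [smul_mk, mk_eq_mk]
  constructor <;> intro h <;> exact h.mono fun _ => (treeDist_comm _ _).le

theorem LimitTree.isArcFreeAction [Finite α] :
    IsArcFreeAction (FreeGroup α) (LimitTree.Btw (s := s) (Φ := Φ)) where
  toIsMedianPretree := LimitTree.isMedianPretree
  smul x {p q t} h := by
    obtain ⟨g, rfl⟩ := p.exists_rep
    obtain ⟨m, rfl⟩ := q.exists_rep
    obtain ⟨h, rfl⟩ := t.exists_rep
    rw [btw_mk] at h
    rw [smul_mk, smul_mk, smul_mk, btw_mk]
    exact h.mono fun _ => (gromovProd_mul_left _ _ _ _).le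
  nonnesting x {p q} hp hB := by
    obtain ⟨g, rfl⟩ := p.exists_rep
    obtain ⟨m, rfl⟩ := q.exists_rep
    rw [smul_mk, btw_mk] at hB
    rw [smul_mk_eq_iff] at hp ⊢
    refine (hp.add hB).mono fun k => ?_
    rw [LimitSeq.smul_apply]
    have h1 := treeDist_triangle ((Φ ^ k) x * m.1 k) (g.1 k) ((Φ ^ k) x * g.1 k)
    rw [treeDist_mul_left] at h1
    have := treeDist_comm ((Φ ^ k) x * m.1 k) (m.1 k)
    have := treeDist_comm (g.1 k) (m.1 k)
    unfold gromovProd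
    omega
  arc_trivial x {p q} hp hq hpq := by
    obtain ⟨g, rfl⟩ := p.exists_rep
    obtain ⟨h, rfl⟩ := q.exists_rep
    by_contra hx
    refine hpq (mk_eq_mk.2 ?_)
    rw [smul_mk_eq_iff] at hp hq
    obtain ⟨E, hE⟩ := exists_period_bound Φ
    have key : ∀ g h : LimitSeq s Φ,
        (s.IsSlow fun k => treeDist (g.1 k) ((Φ ^ k) x * g.1 k)) →
        (s.IsSlow fun k => treeDist (h.1 k) ((Φ ^ k) x * h.1 k)) →
        s.IsSlow fun k => gromovProd 1 (h.1 k) (g.1 k) := by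
      intro g h hg hh
      obtain ⟨y, hy⟩ := g.2
      have h1 := (((hg.add hh).add hy).const_mul (4 * (y.norm + E + 1))).add
        ((LimitScale.IsSlow.const 3).add hy)
      refine h1.mono fun k => ?_
      have h2 := gromovProd_le_of_not_period (c := (Φ ^ k) x) (Y := (Φ ^ k) y)
        (g := g.1 k) (h := h.1 k)
        (N := y.norm + E * k + 1)
        (r := treeDist (g.1 k) ((Φ ^ k) x * g.1 k) + treeDist (h.1 k) ((Φ ^ k) x * h.1 k))
        (by have := treeDist_nonneg (h.1 k) ((Φ ^ k) x * h.1 k); omega)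
        (by have := treeDist_nonneg (g.1 k) ((Φ ^ k) x * g.1 k); omega) ?_
      · refine h2.trans ?_
        rw [← add_assoc _ 3]
        gcongr ?_ + _ + _
        have h3 := treeDist_nonneg (h.1 k) ((Φ ^ k) x * h.1 k)
        have h4 := treeDist_nonneg (g.1 k) ((Φ ^ k) x * g.1 k)
        have h5 := gromovProd_nonneg 1 ((Φ ^ k) y) (g.1 k)
        gcongr ?_ * _
        push_cast
        have : (0 : ℤ) ≤ y.norm * k := by positivity
        have : (0 : ℤ) ≤ E * k := by positivity
        have : (0 : ℤ) ≤ E := by positivity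
        linarith
      · intro w hw
        have := hE x 1 y w k _ hx (by simpa using hw)
        rw [treeDist_one] at this
        push_cast at this
        linarith
    refine ((key g h hp hq).add (key h g hq hp)).mono fun k => ?_
    have := treeDist_comm (g.1 k) (h.1 k)
    have := treeDist_nonneg (g.1 k) (h.1 k)
    have := treeDist_comm (g.1 k) 1
    have := treeDist_comm (h.1 k) 1
    unfold gromovProd
    omega

theorem LimitTree.exists_isSlow_sum [Fintype α] {p : LimitTree s Φ}
    (hp : ∀ i : α, (of i : FreeGroup α) • p = p) :
    ∃ g : ℕ → FreeGroup α,
      s.IsSlow fun k => ∑ i, (((g k)⁻¹ * (Φ ^ k) (of i) * g k).norm : ℤ) := by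
  obtain ⟨g, rfl⟩ := p.exists_rep
  refine ⟨g.1, ?_⟩
  have h : ∀ S : Finset α,
      s.IsSlow fun k => ∑ i ∈ S, (((g.1 k)⁻¹ * (Φ ^ k) (of i) * g.1 k).norm : ℤ) := by
    intro S
    classical
    induction S using Finset.induction_on with
    | empty => exact (LimitScale.IsSlow.const 0).mono fun k => by simp
    | insert i S hi ih =>
      refine ((smul_mk_eq_iff.1 (hp i)).add ih).mono fun k => ?_
      rw [Finset.sum_insert hi, treeDist, mul_assoc]
  exact h _

theorem LimitSeq.exists_isSlow_map [Finite α] (g : LimitSeq s Φ) :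
    ∃ y, s.IsSlow fun k => gromovProd 1 ((Φ ^ k) y) (Φ (g.1 k)) := by
  obtain ⟨y, hy⟩ := g.2
  obtain ⟨L, C, hL, hC, -, hLC⟩ := exists_bounded_cancellation Φ
  obtain ⟨l, rfl⟩ := Int.eq_ofNat_of_zero_le (zero_le_one.trans hL)
  refine ⟨Φ y, ((hy.const_mul l).add (LimitScale.IsSlow.const C)).mono fun k => ?_⟩
  have h1 := hLC 1 ((Φ ^ k) y) (g.1 k)
  rw [apply_pow_comm]
  rw [_root_.map_one] at h1
  refine h1.trans ?_
  have := gromovProd_nonneg 1 ((Φ ^ k) y) (g.1 k)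
  gcongr
  have : (0 : ℤ) ≤ l * k := by positivity
  linarith

theorem isSlow_treeDist_map [Finite α] (Ψ : FreeGroup α ≃* FreeGroup α) {g h : ℕ → FreeGroup α}
    (hgh : s.IsSlow fun k => treeDist (g k) (h k)) :
    s.IsSlow fun k => treeDist (Ψ (g k)) (Ψ (h k)) := by
  obtain ⟨L, hL, hLC⟩ := exists_treeDist_lipschitz Ψ.toMonoidHom
  obtain ⟨l, rfl⟩ := Int.eq_ofNat_of_zero_le (zero_le_one.trans hL)
  refine (hgh.const_mul l).mono fun k => (hLC _ _).trans ?_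
  have := treeDist_nonneg (g k) (h k)
  gcongr
  have : (0 : ℤ) ≤ l * k := by positivity
  linarith

/-- The map on sequences induced by the automorphism. -/
def LimitSeq.shift [Finite α] (g : LimitSeq s Φ) : LimitSeq s Φ :=
  ⟨fun k => Φ (g.1 k), g.exists_isSlow_map⟩

/-- The map of the limit pretree induced by the automorphism. -/
def LimitTree.shift [Finite α] : LimitTree s Φ → LimitTree s Φ :=
  Quotient.map LimitSeq.shift fun _ _ h => isSlow_treeDist_map Φ h

theorem LimitTree.shift_smul [Finite α] (x : FreeGroup α) (p : LimitTree s Φ) :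
    LimitTree.shift (x • p) = Φ x • LimitTree.shift p := by
  obtain ⟨g, rfl⟩ := p.exists_rep
  refine congrArg LimitTree.mk (Subtype.ext ?_)
  funext k
  change Φ ((Φ ^ k) x * g.1 k) = (Φ ^ k) (Φ x) * Φ (g.1 k)
  rw [_root_.map_mul, apply_pow_comm]

theorem LimitTree.shift_injective [Finite α] :
    Function.Injective (LimitTree.shift (s := s) (Φ := Φ)) := by
  intro p q h
  obtain ⟨g, rfl⟩ := p.exists_rep
  obtain ⟨h', rfl⟩ := q.exists_rep
  have h1 : s.IsSlow fun k => treeDist (Φ (g.1 k)) (Φ (h'.1 k)) :=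
    (LimitTree.mk_eq_mk (g := g.shift) (h := h'.shift)).1 h
  have h2 := isSlow_treeDist_map Φ.symm (g := fun k => Φ (g.1 k)) (h := fun k => Φ (h'.1 k)) h1
  simp only [MulEquiv.symm_apply_apply] at h2
  exact LimitTree.mk_eq_mk.2 h2

end ArcTrivial

section Elliptic

variable {n : ℕ} {s : LimitScale} {Φ : FreeGroup (Fin n) ≃* FreeGroup (Fin n)}

theorem LimitTree.exists_smul_eq_iff {x : FreeGroup (Fin n)} :
    (∃ p : LimitTree s Φ, x • p = p) ↔ s.IsSlow fun k => (cyclicLength ((Φ ^ k) x) : ℤ) := by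
  constructor
  · rintro ⟨p, hp⟩
    obtain ⟨g, rfl⟩ := p.exists_rep
    refine (smul_mk_eq_iff.1 hp).mono fun k => ?_
    have := cyclicLength_le_norm_conj (g.1 k)⁻¹ ((Φ ^ k) x)
    rw [treeDist, ← mul_assoc]
    rw [inv_inv] at this
    exact_mod_cast this
  · intro h
    choose u c h1 h2 h3 h4 using fun k => exists_cyclicLength_decomposition ((Φ ^ k) x)
    have hu : s.IsSlow fun k => gromovProd 1 ((Φ ^ k) x) (u k) := by
      refine (LimitScale.IsSlow.const 0).mono fun k => ?_
      have e1 : treeDist (u k) ((Φ ^ k) x) = (c k * (u k)⁻¹).norm := by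
        rw [h1 k, treeDist]
        congr 2
        group
      have e2 := norm_mul_le (c k) (u k)⁻¹
      rw [norm_inv_eq] at e2
      have e3 := h2 k
      rw [gromovProd, treeDist_comm, treeDist_one, treeDist_one, e1, e3]
      omega
    refine ⟨LimitTree.mk (⟨u, x, hu⟩ : LimitSeq s Φ), LimitTree.smul_mk_eq_iff.2 ?_⟩
    refine h.mono fun k => ?_
    rw [← h3 k]
    apply le_of_eq
    change treeDist (u k) ((Φ ^ k) x * u k) = _
    rw [h1 k, treeDist]
    congr 2
    group

end Elliptic

end FreeGroup

namespace FreeGroup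

open Filter Topology

section OuterLipschitz

variable {n : ℕ}

/-- The smallest Lipschitz constant of an automorphism up to inner automorphisms. -/
noncomputable def outerLip (e : FreeGroup (Fin n) ≃* FreeGroup (Fin n)) : ℕ :=
  sInf {L : ℕ | ∃ g : FreeGroup (Fin n), ∀ i, (g * e (of i) * g⁻¹).norm ≤ L}

theorem exists_outerLip (e : FreeGroup (Fin n) ≃* FreeGroup (Fin n)) :
    ∃ g : FreeGroup (Fin n), ∀ i, (g * e (of i) * g⁻¹).norm ≤ outerLip e :=
  Nat.sInf_mem (s := {L : ℕ | ∃ g : FreeGroup (Fin n), ∀ i, (g * e (of i) * g⁻¹).norm ≤ L})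
    ⟨∑ i, (1 * e (of i) * 1⁻¹).norm, 1, fun i =>
      Finset.single_le_sum (f := fun i => (1 * e (of i) * 1⁻¹).norm) (fun _ _ => Nat.zero_le _)
        (Finset.mem_univ i)⟩

theorem outerLip_le {e : FreeGroup (Fin n) ≃* FreeGroup (Fin n)} {L : ℕ} (g : FreeGroup (Fin n))
    (hg : ∀ i, (g * e (of i) * g⁻¹).norm ≤ L) : outerLip e ≤ L :=
  Nat.sInf_le ⟨g, hg⟩

theorem exists_norm_conj_map_le (e : FreeGroup (Fin n) ≃* FreeGroup (Fin n)) :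
    ∃ g : FreeGroup (Fin n), ∀ x, (g * e x * g⁻¹).norm ≤ outerLip e * x.norm := by
  obtain ⟨g, hg⟩ := exists_outerLip e
  exact ⟨g, norm_map_le ((MulAut.conj g).toMonoidHom.comp e.toMonoidHom) hg⟩

theorem outerLip_mul_le (e f : MulAut (FreeGroup (Fin n))) :
    outerLip (e * f) ≤ outerLip e * outerLip f := by
  obtain ⟨g, hg⟩ := exists_norm_conj_map_le e
  obtain ⟨h, hh⟩ := exists_outerLip f
  refine outerLip_le (g * e h) fun i => ?_
  have h1 : g * e h * (e * f) (of i) * (g * e h)⁻¹ = g * e (h * f (of i) * h⁻¹) * g⁻¹ := by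
    simp [mul_assoc]
  rw [h1]
  exact (hg _).trans (Nat.mul_le_mul_left _ (hh i))

theorem one_le_outerLip (hn : 0 < n) (e : FreeGroup (Fin n) ≃* FreeGroup (Fin n)) :
    1 ≤ outerLip e := by
  obtain ⟨g, hg⟩ := exists_outerLip e
  refine le_trans ?_ (hg ⟨0, hn⟩)
  rw [Nat.one_le_iff_ne_zero, Ne, norm_eq_zero, conj_eq_one_iff]
  simp

theorem cyclicLength_map_le (e : FreeGroup (Fin n) ≃* FreeGroup (Fin n)) (x : FreeGroup (Fin n)) :
    cyclicLength (e x) ≤ outerLip e * cyclicLength x := by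
  obtain ⟨g, hg⟩ := exists_norm_conj_map_le e
  obtain ⟨h, hh⟩ := exists_norm_conj_eq_cyclicLength x
  have h1 := cyclicLength_le_norm_conj (g * e h) (e x)
  have h2 : g * e h * e x * (g * e h)⁻¹ = g * e (h * x * h⁻¹) * g⁻¹ := by
    simp [mul_assoc]
  rw [h2] at h1
  exact h1.trans (hh ▸ hg _)

theorem exists_outer_rate (hn : 0 < n) (Φ : FreeGroup (Fin n) ≃* FreeGroup (Fin n)) :
    ∃ A : ℝ, 0 ≤ A ∧ (∀ k : ℕ, Real.exp (A * k) ≤ outerLip (Φ ^ k)) ∧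
      Tendsto (fun k : ℕ => Real.log (outerLip (Φ ^ k)) / k) atTop (𝓝 A) := by
  have hpos : ∀ k : ℕ, (1 : ℝ) ≤ outerLip (Φ ^ k) := fun k => by
    exact_mod_cast one_le_outerLip hn (Φ ^ k)
  have hsub : Subadditive fun k : ℕ => Real.log (outerLip (Φ ^ k)) := by
    intro k l
    rw [← Real.log_mul (by linarith [hpos k]) (by linarith [hpos l])]
    refine Real.log_le_log (by linarith [hpos (k + l)]) ?_
    rw [pow_add]
    exact_mod_cast outerLip_mul_le (Φ ^ k) (Φ ^ l)
  have hbdd : BddBelow (Set.range fun k : ℕ => Real.log (outerLip (Φ ^ k)) / k) := by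
    refine ⟨0, ?_⟩
    rintro _ ⟨k, rfl⟩
    exact div_nonneg (Real.log_nonneg (hpos k)) (Nat.cast_nonneg k)
  have hlim := hsub.tendsto_lim hbdd
  refine ⟨hsub.lim, ?_, fun k => ?_, hlim⟩
  · exact ge_of_tendsto' hlim fun k => div_nonneg (Real.log_nonneg (hpos k)) (Nat.cast_nonneg k)
  · rcases Nat.eq_zero_or_pos k with rfl | hk
    · simpa using hpos 0
    · have h1 := hsub.lim_le_div hbdd hk.ne'
      have hk' : (0 : ℝ) < k := by exact_mod_cast hk
      rw [le_div_iff₀ hk'] at h1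
      rwa [← Real.le_log_iff_exp_le (by linarith [hpos k])]

end OuterLipschitz

section GrowthRate

variable {n : ℕ}

/-- The conjugacy length of `x` grows at exponential rate `lam` under iteration of `Φ`. -/
def HasGrowthRate (Φ : FreeGroup (Fin n) ≃* FreeGroup (Fin n)) (x : FreeGroup (Fin n))
    (lam : ℝ) : Prop :=
  Tendsto (fun k : ℕ => (1 / (k : ℝ)) * Real.log (cyclicLength ((Φ ^ k) x))) atTop
    (𝓝 (Real.log lam))

theorem pow_apply_ne_one {Φ : FreeGroup (Fin n) ≃* FreeGroup (Fin n)} {x : FreeGroup (Fin n)}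
    (hx : x ≠ 1) (k : ℕ) : (Φ ^ k) x ≠ 1 := by simpa using hx

theorem one_le_cyclicLength_pow {Φ : FreeGroup (Fin n) ≃* FreeGroup (Fin n)}
    {x : FreeGroup (Fin n)} (hx : x ≠ 1) (k : ℕ) : (1 : ℝ) ≤ cyclicLength ((Φ ^ k) x) := by
  exact_mod_cast one_le_cyclicLength (pow_apply_ne_one hx k)

theorem rate_nonneg {Φ : FreeGroup (Fin n) ≃* FreeGroup (Fin n)}
    {x : FreeGroup (Fin n)} (hx : x ≠ 1) (k : ℕ) :
    0 ≤ (1 / (k : ℝ)) * Real.log (cyclicLength ((Φ ^ k) x)) :=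
  mul_nonneg (by positivity) (Real.log_nonneg (one_le_cyclicLength_pow hx k))

theorem exists_rate_upper_bound (hn : 0 < n) {Φ : FreeGroup (Fin n) ≃* FreeGroup (Fin n)} {A : ℝ}
    (hA : Tendsto (fun k : ℕ => Real.log (outerLip (Φ ^ k)) / k) atTop (𝓝 A))
    {x : FreeGroup (Fin n)} (hx : x ≠ 1) :
    ∃ b : ℕ → ℝ, Tendsto b atTop (𝓝 A) ∧
      ∀ k : ℕ, (1 / (k : ℝ)) * Real.log (cyclicLength ((Φ ^ k) x)) ≤ b k := by
  refine ⟨fun k => Real.log (outerLip (Φ ^ k)) / k + Real.log (cyclicLength x) / k, ?_, ?_⟩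
  · simpa using hA.add (tendsto_const_div_atTop_nhds_zero_nat (Real.log (cyclicLength x)))
  · intro k
    beta_reduce
    have h0 := one_le_cyclicLength_pow (Φ := Φ) hx 0
    rw [pow_zero, MulAut.one_apply] at h0
    have h1 : (1 : ℝ) ≤ outerLip (Φ ^ k) := by exact_mod_cast one_le_outerLip hn (Φ ^ k)
    have h2 : (cyclicLength ((Φ ^ k) x) : ℝ) ≤ outerLip (Φ ^ k) * cyclicLength x := by
      exact_mod_cast cyclicLength_map_le (Φ ^ k) x
    have h3 := Real.log_le_log (by linarith [one_le_cyclicLength_pow (Φ := Φ) hx k]) h2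
    rw [Real.log_mul (by linarith) (by linarith)] at h3
    rw [← add_div, one_div, inv_mul_eq_div]
    gcongr

theorem exists_finite_rates_of_slow (hn : 0 < n) {Φ : FreeGroup (Fin n) ≃* FreeGroup (Fin n)}
    {A : ℝ} (hA0 : 0 < A)
    (hA : Tendsto (fun k : ℕ => Real.log (outerLip (Φ ^ k)) / k) atTop (𝓝 A))
    (hslow : ∀ s : LimitScale, s.rate = A → ∃ Λ : Finset ℝ, (∀ lam ∈ Λ, (1 : ℝ) ≤ lam) ∧
      ∀ x, x ≠ 1 → (s.IsSlow fun k => (cyclicLength ((Φ ^ k) x) : ℤ)) →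
        ∃ lam ∈ Λ, HasGrowthRate Φ x lam) :
    ∃ Λ : Finset ℝ, (∀ lam ∈ Λ, (1 : ℝ) ≤ lam) ∧
      ∀ x, x ≠ 1 → ∃ lam ∈ Λ, HasGrowthRate Φ x lam := by
  have slow_of_eventually : ∀ (s : LimitScale), s.rate = A → ∀ x, x ≠ 1 → ∀ δ > 0,
      (∀ᶠ k : ℕ in (s.toUltrafilter : Filter ℕ),
        (1 / (k : ℝ)) * Real.log (cyclicLength ((Φ ^ k) x)) < A - δ) →
      s.IsSlow fun k => (cyclicLength ((Φ ^ k) x) : ℤ) := by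
    intro s hs x hx δ hδ h
    refine ⟨δ, hδ, ?_⟩
    filter_upwards [h, s.le_atTop (eventually_gt_atTop 0)] with k h1 hk
    have hk' : (0 : ℝ) < k := by exact_mod_cast hk
    rw [one_div, inv_mul_eq_div, div_lt_iff₀ hk'] at h1
    rw [Int.cast_natCast, hs]
    exact ((Real.log_lt_iff_lt_exp (by linarith [one_le_cyclicLength_pow (Φ := Φ) hx k])).1 h1).le
  let s₀ : LimitScale := ⟨hyperfilter ℕ, Nat.hyperfilter_le_atTop, A, hA0⟩
  obtain ⟨Λ, hΛ1, hΛ⟩ := hslow s₀ rfl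
  classical
  refine ⟨insert (Real.exp A) Λ, ?_, fun x hx => ?_⟩
  · intro lam h
    rcases Finset.mem_insert.1 h with rfl | h
    · exact Real.one_le_exp hA0.le
    · exact hΛ1 lam h
  by_cases hx0 : s₀.IsSlow fun k => (cyclicLength ((Φ ^ k) x) : ℤ)
  · obtain ⟨lam, h1, h2⟩ := hΛ x hx hx0
    exact ⟨lam, Finset.mem_insert_of_mem h1, h2⟩
  refine ⟨Real.exp A, Finset.mem_insert_self _ _, ?_⟩
  obtain ⟨b, hb, hbx⟩ := exists_rate_upper_bound hn hA hx
  unfold HasGrowthRate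
  rw [Real.log_exp]
  refine tendsto_order.2 ⟨fun a ha => ?_, fun a ha => ?_⟩
  · by_contra hfreq
    rw [not_eventually, frequently_iff_neBot] at hfreq
    let ω := Ultrafilter.of (atTop ⊓ 𝓟 {k : ℕ | ¬ a <
      (1 / (k : ℝ)) * Real.log (cyclicLength ((Φ ^ k) x))})
    have hω : (ω : Filter ℕ) ≤ _ := Ultrafilter.of_le _
    let s : LimitScale := ⟨ω, hω.trans inf_le_left, A, hA0⟩
    have hs : ∀ᶠ k : ℕ in (ω : Filter ℕ),
        (1 / (k : ℝ)) * Real.log (cyclicLength ((Φ ^ k) x)) ≤ a :=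
      (hω.trans inf_le_right) (by simp)
    obtain ⟨Λ', -, hΛ'⟩ := hslow s rfl
    obtain ⟨lam, -, hlam⟩ := hΛ' x hx (slow_of_eventually s rfl x hx ((A - a) / 2) (by linarith)
      (hs.mono fun k hk => by linarith))
    have hle : Real.log lam ≤ a := le_of_tendsto (hlam.mono_left s.le_atTop) hs
    refine hx0 (slow_of_eventually s₀ rfl x hx ((A - a) / 2) (by linarith) ?_)
    exact (hlam.mono_left s₀.le_atTop).eventually (gt_mem_nhds (by linarith))
  · exact (hb.eventually (gt_mem_nhds ha)).mono fun k hk => (hbx k).trans_lt hk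

theorem hasGrowthRate_one (hn : 0 < n) {Φ : FreeGroup (Fin n) ≃* FreeGroup (Fin n)}
    (hA : Tendsto (fun k : ℕ => Real.log (outerLip (Φ ^ k)) / k) atTop (𝓝 0))
    {x : FreeGroup (Fin n)} (hx : x ≠ 1) : HasGrowthRate Φ x 1 := by
  obtain ⟨b, hb, hbx⟩ := exists_rate_upper_bound hn hA hx
  unfold HasGrowthRate
  rw [Real.log_one]
  exact squeeze_zero (rate_nonneg hx) hbx hb

theorem LimitTree.exists_smul_ne {s : LimitScale} {Φ : FreeGroup (Fin n) ≃* FreeGroup (Fin n)}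
    (hexp : ∀ k : ℕ, Real.exp (s.rate * k) ≤ outerLip (Φ ^ k)) (p : LimitTree s Φ) :
    ∃ i : Fin n, (of i : FreeGroup (Fin n)) • p ≠ p := by
  by_contra! h
  obtain ⟨g, δ, hδ, hg⟩ := LimitTree.exists_isSlow_sum h
  obtain ⟨k, hk, hk0⟩ := (hg.and (s.le_atTop (eventually_gt_atTop 0))).exists
  have h1 : outerLip (Φ ^ k) ≤ ∑ i, ((g k)⁻¹ * (Φ ^ k) (of i) * g k).norm := by
    refine outerLip_le (g k)⁻¹ fun i => ?_
    rw [inv_inv]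
    exact Finset.single_le_sum (f := fun i => ((g k)⁻¹ * (Φ ^ k) (of i) * g k).norm)
      (fun _ _ => Nat.zero_le _) (Finset.mem_univ i)
  have h2 : (outerLip (Φ ^ k) : ℝ) ≤
      ((∑ i, (((g k)⁻¹ * (Φ ^ k) (of i) * g k).norm : ℤ) : ℤ) : ℝ) := by exact_mod_cast h1
  have h3 := Real.exp_le_exp.1 ((hexp k).trans (h2.trans hk))
  have hk' : (0 : ℝ) < k := by exact_mod_cast hk0
  nlinarith

end GrowthRate

end FreeGroup

namespace FreeGroup

open Filter Topology

section Comparison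

theorem finite_setOf_norm_le {α : Type*} [DecidableEq α] [Finite α] (N : ℕ) :
    {x : FreeGroup α | x.norm ≤ N}.Finite := by
  have h := List.finite_length_le (α × Bool) N
  exact (h.preimage (f := toWord) toWord_injective.injOn).subset fun x hx => hx

variable {α β : Type*} [DecidableEq α] [DecidableEq β]

theorem exists_norm_le_of_injective [Finite α] [Finite β] {φ : FreeGroup α →* FreeGroup β}
    (hφ : Function.Injective φ) : ∃ L K : ℕ, (∀ y, (φ y).norm ≤ L * y.norm) ∧
      (∀ y, y.norm ≤ K * ((φ y).norm + 1)) ∧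
      ∀ y z, gromovProd 1 (φ y) z = 0 → ∃ v, treeDist (φ v) z ≤ L := by
  obtain ⟨L, hL1, hL⟩ := exists_lipschitz φ
  have hL' : ∀ u v, treeDist (φ u) (φ v) ≤ L * treeDist u v := fun u v => by
    unfold treeDist
    rw [← _root_.map_inv, ← _root_.map_mul]
    exact_mod_cast hL _
  have hnear : ∀ y z, gromovProd 1 (φ y) z = 0 → ∃ v, treeDist (φ v) z ≤ L := by
    intro y z hz
    rw [← _root_.map_one φ] at hz
    obtain ⟨v, -, hv⟩ := exists_near_of_gromovProd_eq_zero φ (by positivity) hL' 1 y z hz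
    exact ⟨v, hv⟩
  obtain ⟨K, hK⟩ : ∃ K : ℕ, ∀ y, (φ y).norm ≤ 2 * L + 1 → y.norm ≤ K := by
    have hfin := (finite_setOf_norm_le (α := β) (2 * L + 1)).preimage hφ.injOn
    obtain ⟨K, hK⟩ := (hfin.image FreeGroup.norm).bddAbove
    exact ⟨K, fun y hy => hK ⟨y, hy, rfl⟩⟩
  have hK' : ∀ u v, treeDist (φ u) (φ v) ≤ 2 * L + 1 → treeDist u v ≤ K := fun u v h => by
    unfold treeDist at *
    rw [← _root_.map_inv, ← _root_.map_mul] at h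
    exact_mod_cast hK _ (by exact_mod_cast h)
  refine ⟨L, K, hL, fun y => ?_, hnear⟩
  have key : ∀ d : ℕ, ∀ z, gromovProd 1 (φ y) z = 0 → treeDist 1 z = d →
      ∃ v, treeDist (φ v) z ≤ L ∧ treeDist 1 v ≤ K * d := by
    intro d
    induction d with
    | zero =>
      intro z _ hz
      rw [Nat.cast_zero, treeDist_eq_zero] at hz
      subst hz
      exact ⟨1, by simp [treeDist_self], by simp [treeDist_self]⟩
    | succ d ih =>
      intro z hz hd
      obtain ⟨z', h1, h2⟩ := exists_between 1 z d (by omega) (by rw [hd]; push_cast; omega)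
      have h3 := gromovProd_le_add 1 (φ y) z z'
      have h4 := gromovProd_nonneg 1 (φ y) z'
      obtain ⟨v', h5, h6⟩ := ih z' (by omega) h2
      obtain ⟨v, h7⟩ := hnear y z hz
      refine ⟨v, h7, ?_⟩
      have h8 : treeDist v' v ≤ K := by
        apply hK'
        have := treeDist_triangle (φ v') z' (φ v)
        have := treeDist_triangle z' z (φ v)
        have := treeDist_comm z (φ v)
        have := treeDist_comm z' 1
        unfold gromovProd at h1
        push_cast at hd
        omega
      have := treeDist_triangle 1 v' v
      push_cast
      linarith
  obtain ⟨v, h1, h2⟩ := key (φ y).norm (φ y) (by simp [gromovProd, treeDist_self, treeDist_comm])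
    (treeDist_one _)
  have h3 := hK' v y (h1.trans (by omega))
  have h4 := treeDist_triangle 1 v y
  rw [treeDist_one y] at h4
  have : (y.norm : ℤ) ≤ K * ((φ y).norm + 1) := by linarith
  exact_mod_cast this

theorem exists_cyclicLength_comparison {n r : ℕ} {φ : FreeGroup (Fin r) →* FreeGroup (Fin n)}
    (hφ : Function.Injective φ) : ∃ K : ℕ, 1 ≤ K ∧ ∀ y, y ≠ 1 →
      cyclicLength (φ y) ≤ K * cyclicLength y ∧ cyclicLength y ≤ K * cyclicLength (φ y) := by
  obtain ⟨L, K, hL, hK, hnear⟩ := exists_norm_le_of_injective hφ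
  refine ⟨L + K * (2 * L + 2) + 1, by omega, fun y hy => ⟨?_, ?_⟩⟩
  · obtain ⟨g, hg⟩ := exists_norm_conj_eq_cyclicLength y
    have h1 := cyclicLength_le_norm_conj (φ g) (φ y)
    have h2 := hL (g * y * g⁻¹)
    simp only [_root_.map_mul, _root_.map_inv] at h2
    rw [hg] at h2
    nlinarith
  · obtain ⟨u, c, h1, h2, h3, -⟩ := exists_cyclicLength_decomposition (φ y)
    have hu : gromovProd 1 (φ y) u = 0 := by
      have e1 : treeDist u (φ y) = (c * u⁻¹).norm := by
        rw [h1, treeDist]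
        congr 2
        group
      have e2 := norm_mul_le c u⁻¹
      rw [norm_inv_eq] at e2
      have e3 := gromovProd_nonneg 1 (φ y) u
      rw [gromovProd, treeDist_comm u 1, treeDist_one, treeDist_one, e1, h2] at e3 ⊢
      omega
    obtain ⟨v, hv⟩ := hnear y u hu
    have h4 := cyclicLength_le_norm_conj v⁻¹ y
    have h5 := hK (v⁻¹ * y * v⁻¹⁻¹)
    have h6 : φ (v⁻¹ * y * v⁻¹⁻¹) = ((φ v)⁻¹ * u) * c * ((φ v)⁻¹ * u)⁻¹ := by
      simp only [_root_.map_mul, _root_.map_inv]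
      nth_rw 1 [h1]
      group
    have h7 : ((φ v)⁻¹ * u).norm ≤ L := by
      unfold treeDist at hv
      exact_mod_cast hv
    have h8 : (φ (v⁻¹ * y * v⁻¹⁻¹)).norm ≤ c.norm + 2 * L := by
      rw [h6]
      have e1 := norm_mul_le ((φ v)⁻¹ * u * c) ((φ v)⁻¹ * u)⁻¹
      have e2 := norm_mul_le ((φ v)⁻¹ * u) c
      rw [norm_inv_eq] at e1
      omega
    have h9 : 1 ≤ cyclicLength (φ y) :=
      one_le_cyclicLength (by rwa [Ne, map_eq_one_iff φ hφ])
    calc cyclicLength y ≤ K * ((φ (v⁻¹ * y * v⁻¹⁻¹)).norm + 1) := h4.trans h5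
      _ ≤ K * (cyclicLength (φ y) + 2 * L + 1) := by gcongr; omega
      _ ≤ K * ((2 * L + 2) * cyclicLength (φ y)) := by gcongr; nlinarith
      _ ≤ _ := by nlinarith

end Comparison

section RateTransfer

theorem tendsto_rate_of_div {f G : ℕ → ℝ} {D l : ℝ} {m : ℕ} (hm : 0 < m)
    (h : ∀ k, |f k - G (k / m)| ≤ D)
    (hG : Tendsto (fun j : ℕ => (1 / (j : ℝ)) * G j) atTop (𝓝 l)) :
    Tendsto (fun k : ℕ => (1 / (k : ℝ)) * f k) atTop (𝓝 (l / m)) := by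
  have hm' : (0 : ℝ) < m := by exact_mod_cast hm
  have hdiv : Tendsto (fun k : ℕ => k / m) atTop atTop := Nat.tendsto_div_const_atTop hm.ne'
  have h1 : Tendsto (fun k : ℕ => ((k / m : ℕ) : ℝ) / k) atTop (𝓝 (1 / m)) := by
    have := (tendsto_nat_floor_mul_div_atTop (R := ℝ) (a := 1 / m) (by positivity)).comp
      tendsto_natCast_atTop_atTop
    refine this.congr fun k => ?_
    simp only [Function.comp_apply]
    rw [one_div, inv_mul_eq_div, Nat.floor_div_eq_div]
  have h2 := (hG.comp hdiv).mul h1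
  have h3 : Tendsto (fun k : ℕ => (1 / (k : ℝ)) * (f k - G (k / m))) atTop (𝓝 0) := by
    refine squeeze_zero_norm (fun k => ?_) (tendsto_const_div_atTop_nhds_zero_nat D)
    rw [norm_mul, Real.norm_eq_abs, Real.norm_eq_abs, abs_of_nonneg (by positivity), one_div,
      inv_mul_eq_div]
    gcongr
    exact h k
  have h4 := h2.add h3
  rw [add_zero, mul_one_div] at h4
  refine h4.congr' ?_
  filter_upwards [hdiv.eventually_gt_atTop 0] with k hk
  have hk' : ((k / m : ℕ) : ℝ) ≠ 0 := by exact_mod_cast hk.ne'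
  simp only [Function.comp_apply]
  field_simp
  ring

variable {n : ℕ}

theorem HasGrowthRate.conj {Φ : FreeGroup (Fin n) ≃* FreeGroup (Fin n)} {x : FreeGroup (Fin n)}
    {lam : ℝ} (h : HasGrowthRate Φ x lam) (g : FreeGroup (Fin n)) :
    HasGrowthRate Φ (g * x * g⁻¹) lam := by
  unfold HasGrowthRate at *
  simpa only [_root_.map_mul, _root_.map_inv, cyclicLength_conj] using h

theorem exists_log_cyclicLength_lipschitz (Φ : FreeGroup (Fin n) ≃* FreeGroup (Fin n)) :
    ∃ D : ℝ, 0 ≤ D ∧ ∀ x, x ≠ 1 →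
      |Real.log (cyclicLength (Φ x)) - Real.log (cyclicLength x)| ≤ D := by
  obtain ⟨K, hK1, hK⟩ := exists_cyclicLength_comparison (φ := Φ.toMonoidHom) Φ.injective
  refine ⟨Real.log K, Real.log_natCast_nonneg K, fun x hx => ?_⟩
  obtain ⟨h1, h2⟩ := hK x hx
  have p1 : (1 : ℝ) ≤ cyclicLength x := by exact_mod_cast one_le_cyclicLength hx
  have p2 : (1 : ℝ) ≤ cyclicLength (Φ x) := by
    exact_mod_cast one_le_cyclicLength (by simpa using hx)
  have p3 : (1 : ℝ) ≤ K := by exact_mod_cast hK1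
  have q1 : (cyclicLength (Φ x) : ℝ) ≤ K * cyclicLength x := by exact_mod_cast h1
  have q2 : (cyclicLength x : ℝ) ≤ K * cyclicLength (Φ x) := by exact_mod_cast h2
  have r1 := Real.log_le_log (by linarith) q1
  have r2 := Real.log_le_log (by linarith) q2
  rw [Real.log_mul (by linarith) (by linarith)] at r1 r2
  rw [abs_le]
  constructor <;> linarith

theorem HasGrowthRate.of_subgroup {r m : ℕ} (hm : 0 < m)
    {Φ : FreeGroup (Fin n) ≃* FreeGroup (Fin n)} {Ψ : FreeGroup (Fin r) ≃* FreeGroup (Fin r)}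
    {φ : FreeGroup (Fin r) →* FreeGroup (Fin n)} (hφ : Function.Injective φ)
    {h : FreeGroup (Fin n)} (hΨ : ∀ y, φ (Ψ y) = h⁻¹ * (Φ ^ m) (φ y) * h)
    {y : FreeGroup (Fin r)} (hy : y ≠ 1) {μ : ℝ} (hμ : 1 ≤ μ) (hrate : HasGrowthRate Ψ y μ) :
    HasGrowthRate Φ (φ y) (μ ^ (1 / (m : ℝ))) := by
  obtain ⟨K, hK1, hK⟩ := exists_cyclicLength_comparison hφ
  obtain ⟨D, hD0, hD⟩ := exists_log_cyclicLength_lipschitz Φ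
  have hx : φ y ≠ 1 := by rwa [Ne, map_eq_one_iff φ hφ]
  have hconj : ∀ j, ∃ g, φ ((Ψ ^ j) y) = g * (Φ ^ (m * j)) (φ y) * g⁻¹ := by
    intro j
    induction j with
    | zero => exact ⟨1, by simp⟩
    | succ j ih =>
      obtain ⟨g, hg⟩ := ih
      refine ⟨h⁻¹ * (Φ ^ m) g, ?_⟩
      rw [pow_succ', MulAut.mul_apply, hΨ, hg, Nat.mul_succ, add_comm, pow_add, MulAut.mul_apply]
      simp [mul_assoc]
  have hcyc : ∀ j, cyclicLength (φ ((Ψ ^ j) y)) = cyclicLength ((Φ ^ (m * j)) (φ y)) := by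
    intro j
    obtain ⟨g, hg⟩ := hconj j
    rw [hg, cyclicLength_conj]
  have hsteps : ∀ k i : ℕ, |Real.log (cyclicLength ((Φ ^ (k + i)) (φ y))) -
      Real.log (cyclicLength ((Φ ^ k) (φ y)))| ≤ i * D := by
    intro k i
    induction i with
    | zero => simp
    | succ i ih =>
      have h1 := hD _ (pow_apply_ne_one (Φ := Φ) hx (k + i))
      rw [← MulAut.mul_apply, ← pow_succ'] at h1
      rw [abs_le] at *
      rw [← add_assoc]
      push_cast
      constructor <;> linarith
  have hcomp : ∀ j, |Real.log (cyclicLength ((Φ ^ (m * j)) (φ y))) -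
      Real.log (cyclicLength ((Ψ ^ j) y))| ≤ Real.log K := by
    intro j
    obtain ⟨h1, h2⟩ := hK _ (pow_apply_ne_one (Φ := Ψ) hy j)
    rw [hcyc] at h1 h2
    have p1 := one_le_cyclicLength_pow (Φ := Ψ) hy j
    have p2 := one_le_cyclicLength_pow (Φ := Φ) hx (m * j)
    have p3 : (1 : ℝ) ≤ K := by exact_mod_cast hK1
    have q1 : (cyclicLength ((Φ ^ (m * j)) (φ y)) : ℝ) ≤ K * cyclicLength ((Ψ ^ j) y) := by
      exact_mod_cast h1
    have q2 : (cyclicLength ((Ψ ^ j) y) : ℝ) ≤ K * cyclicLength ((Φ ^ (m * j)) (φ y)) := by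
      exact_mod_cast h2
    have r1 := Real.log_le_log (by linarith) q1
    have r2 := Real.log_le_log (by linarith) q2
    rw [Real.log_mul (by linarith) (by linarith)] at r1 r2
    rw [abs_le]
    constructor <;> linarith
  unfold HasGrowthRate at *
  rw [Real.log_rpow (by linarith), one_div_mul_eq_div]
  refine tendsto_rate_of_div hm (D := m * D + Real.log K) (fun k => ?_) hrate
  have h1 := hsteps (m * (k / m)) (k % m)
  rw [Nat.div_add_mod] at h1
  have h2 := hcomp (k / m)
  have h3 : ((k % m : ℕ) : ℝ) * D ≤ m * D := by
    gcongr
    exact (Nat.mod_lt k hm).le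
  rw [abs_le] at *
  constructor <;> linarith

end RateTransfer

end FreeGroup

namespace IsArcFreeAction

open MulAction

variable {ι P : Type*} [MulAction (FreeGroup ι) P] {B : P → P → P → Prop}

theorem card_add_two_le [Fintype ι] (hA : IsArcFreeAction (FreeGroup ι) B)
    (hfix : ∀ p : P, ∃ i : ι, (FreeGroup.of i : FreeGroup ι) • p ≠ p) (pts : Finset P)
    (hne : pts.Nonempty)
    (horb : ∀ p ∈ pts, ∀ q ∈ pts, ∀ g : FreeGroup ι, g • p = q → p = q)
    (hpts : ∀ p ∈ pts, stabilizer (FreeGroup ι) p ≠ ⊥) :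
    pts.card + 2 ≤ 2 * Fintype.card ι := by
  have h : ∀ p : P, ∃ (χ : FreeGroup ι → ZMod 2) (x : FreeGroup ι), p ∈ pts →
      (∀ g h, g • p = p → h • p = p → χ (g * h) = χ g + χ h) ∧ x • p = p ∧ χ x = 1 := by
    intro p
    by_cases hp : p ∈ pts
    · obtain ⟨χ, h1, x, hx, h2⟩ := FreeGroup.exists_character_of_ne_bot (hpts p hp)
      exact ⟨χ, x, fun _ => ⟨fun g h hg hh => h1 g hg h hh, hx, h2⟩⟩
    · exact ⟨0, 1, fun h => absurd h hp⟩
  choose χ x hχ using h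
  have := hA.sum_two_mul_add_two_le hfix pts hne horb (fun _ => 1) (fun _ _ => le_rfl)
    (fun p _ => x p) (fun p hp _ => (hχ p hp).2.1) (fun p _ => χ p)
    (fun p hp _ => (hχ p hp).1)
    (fun p hp a a' => by rw [Subsingleton.elim a a', if_pos rfl]; exact (hχ p hp).2.2)
  simp only [mul_one, Finset.sum_const, smul_eq_mul] at this
  omega

theorem finite_orbits [Fintype ι] (hA : IsArcFreeAction (FreeGroup ι) B)
    (hfix : ∀ p : P, ∃ i : ι, (FreeGroup.of i : FreeGroup ι) • p ≠ p) :
    {o : orbitRel.Quotient (FreeGroup ι) P |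
      stabilizer (FreeGroup ι) (Quotient.out o) ≠ ⊥}.Finite := by
  classical
  by_contra hinf
  obtain ⟨t, ht, hcard⟩ := Set.Infinite.exists_subset_card_eq hinf (2 * Fintype.card ι + 1)
  have hinj : Function.Injective
      (Quotient.out : orbitRel.Quotient (FreeGroup ι) P → P) := Quotient.out_injective
  have h := hA.card_add_two_le hfix (t.image Quotient.out)
    (by rw [Finset.image_nonempty, ← Finset.card_pos]; omega) ?_ ?_
  · rw [Finset.card_image_of_injective _ hinj] at h
    omega
  · intro p hp q hq g hg
    obtain ⟨o, -, rfl⟩ := Finset.mem_image.1 hp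
    obtain ⟨o', -, rfl⟩ := Finset.mem_image.1 hq
    congr 1
    rw [← Quotient.out_eq o, ← Quotient.out_eq o', ← hg]
    exact (Quotient.sound (orbitRel_apply.2 ⟨g, rfl⟩)).symm
  · intro p hp
    obtain ⟨o, ho, rfl⟩ := Finset.mem_image.1 hp
    exact ht ho

theorem exists_stabilizer_equiv [Fintype ι] (hA : IsArcFreeAction (FreeGroup ι) B)
    (hfix : ∀ p : P, ∃ i : ι, (FreeGroup.of i : FreeGroup ι) • p ≠ p) (p : P) :
    ∃ r < Fintype.card ι, Nonempty (FreeGroup (Fin r) ≃* stabilizer (FreeGroup ι) p) := by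
  classical
  set b := IsFreeGroup.basis (stabilizer (FreeGroup ι) p)
  obtain ⟨χ, h1, h2⟩ := FreeGroup.exists_dual_characters b
  have hcard : ∀ t : Finset (IsFreeGroup.Generators (stabilizer (FreeGroup ι) p)),
      t.Nonempty → t.card < Fintype.card ι := by
    intro t ht
    have h := hA.sum_two_mul_add_two_le hfix {p} (Finset.singleton_nonempty p)
      (by simp) (fun _ => t.card) (fun _ _ => ht.card_pos)
      (fun _ a => b (t.equivFin.symm a)) ?_ (fun _ a => χ (t.equivFin.symm a)) ?_ ?_
    · simp only [Finset.sum_singleton, Finset.card_singleton] at h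
      omega
    · intro q hq a
      rw [Finset.mem_singleton.1 hq]
      exact (b (t.equivFin.symm a)).2
    · intro q hq a g h hg hh
      rw [Finset.mem_singleton.1 hq] at hg hh
      exact h1 _ g hg h hh
    · intro q hq a a'
      rw [h2]
      simp
  have hι : 0 < Fintype.card ι := by
    obtain ⟨i, -⟩ := hfix p
    exact Fintype.card_pos_iff.2 ⟨i⟩
  have hfin : Finite (IsFreeGroup.Generators (stabilizer (FreeGroup ι) p)) := by
    by_contra hinf
    rw [not_finite_iff_infinite] at hinf
    obtain ⟨t, ht⟩ := Infinite.exists_subset_card_eq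
      (IsFreeGroup.Generators (stabilizer (FreeGroup ι) p)) (Fintype.card ι)
    have := hcard t (by rw [← Finset.card_pos]; omega)
    omega
  have := Fintype.ofFinite (IsFreeGroup.Generators (stabilizer (FreeGroup ι) p))
  refine ⟨Fintype.card (IsFreeGroup.Generators (stabilizer (FreeGroup ι) p)), ?_,
    ⟨(FreeGroup.freeGroupCongr (Fintype.equivFin _).symm).trans b.repr.symm⟩⟩
  rcases (Finset.univ : Finset (IsFreeGroup.Generators (stabilizer (FreeGroup ι) p))).eq_empty_or_nonempty
    with h | h
  · rw [← Finset.card_univ, h]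
    simpa using hι
  · exact hcard _ h

end IsArcFreeAction

namespace FreeGroup

open MulAction

section Shift

variable {α : Type*} [DecidableEq α] [Finite α] {s : LimitScale} {Φ : FreeGroup α ≃* FreeGroup α}

theorem LimitTree.iterate_shift_smul (m : ℕ) (x : FreeGroup α) (p : LimitTree s Φ) :
    LimitTree.shift^[m] (x • p) = (Φ ^ m) x • LimitTree.shift^[m] p := by
  induction m with
  | zero => simp
  | succ m ih =>
    rw [Function.iterate_succ_apply', ih, shift_smul, ← Function.iterate_succ_apply' shift,
      pow_succ', MulAut.mul_apply]

theorem LimitTree.iterate_shift_smul_eq_iff {m : ℕ} {x : FreeGroup α} {p : LimitTree s Φ} :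
    (Φ ^ m) x • LimitTree.shift^[m] p = LimitTree.shift^[m] p ↔ x • p = p := by
  rw [← iterate_shift_smul, (shift_injective.iterate m).eq_iff]

/-- A point with nontrivial stabilizer is periodic up to the action. -/
theorem LimitTree.exists_iterate_shift_eq [Fintype α]
    (hfix : ∀ p : LimitTree s Φ, ∃ i : α, (of i : FreeGroup α) • p ≠ p)
    {p : LimitTree s Φ} {x : FreeGroup α} (hx : x ≠ 1) (hxp : x • p = p) :
    ∃ m, 0 < m ∧ ∃ h : FreeGroup α, LimitTree.shift^[m] p = h • p := by
  have hfin := isArcFreeAction.finite_orbits hfix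
  have := hfin.to_subtype
  have hstab : ∀ k, stabilizer (FreeGroup α)
      (Quotient.out (Quotient.mk (orbitRel (FreeGroup α) (LimitTree s Φ))
        (LimitTree.shift^[k] p))) ≠ ⊥ := by
    intro k hbot
    obtain ⟨g, hg⟩ := orbitRel_apply.1 (Quotient.mk_out (s := orbitRel (FreeGroup α)
      (LimitTree s Φ)) (LimitTree.shift^[k] p))
    have h1 : g * (Φ ^ k) x * g⁻¹ ∈ (⊥ : Subgroup (FreeGroup α)) := by
      rw [← hbot, mem_stabilizer_iff, ← hg]
      simp only [mul_smul, inv_smul_smul]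
      rw [iterate_shift_smul_eq_iff.2 hxp]
    rw [Subgroup.mem_bot, conj_eq_one_iff] at h1
    exact hx (by simpa using h1)
  let f : ℕ → {o : orbitRel.Quotient (FreeGroup α) (LimitTree s Φ) |
      stabilizer (FreeGroup α) (Quotient.out o) ≠ ⊥} := fun k => ⟨Quotient.mk _ _, hstab k⟩
  obtain ⟨i, j, hij, hf⟩ : ∃ i j, i < j ∧ f i = f j := by
    obtain ⟨i, j, hij, hf⟩ := Finite.exists_ne_map_eq_of_infinite f
    rcases lt_or_gt_of_ne hij with h | h
    · exact ⟨i, j, h, hf⟩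
    · exact ⟨j, i, h, hf.symm⟩
  obtain ⟨g, hg⟩ := orbitRel_apply.1 (Quotient.exact (congrArg Subtype.val hf).symm)
  refine ⟨j - i, by omega, (Φ ^ i).symm g, ?_⟩
  apply shift_injective.iterate i
  rw [← Function.iterate_add_apply, Nat.add_sub_cancel' hij.le, iterate_shift_smul]
  simpa using hg.symm

end Shift

end FreeGroup

namespace FreeGroup

open MulAction

variable {n : ℕ}

/-- Only finitely many growth rates occur for automorphisms of the free group of rank `n`. -/
def FinitelyManyRates (n : ℕ) : Prop :=
  ∀ Φ : FreeGroup (Fin n) ≃* FreeGroup (Fin n), ∃ Λ : Finset ℝ, (∀ lam ∈ Λ, (1 : ℝ) ≤ lam) ∧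
    ∀ x, x ≠ 1 → ∃ lam ∈ Λ, HasGrowthRate Φ x lam

theorem exists_finite_rates_of_fixed_point {s : LimitScale}
    {Φ : FreeGroup (Fin n) ≃* FreeGroup (Fin n)}
    (hfix : ∀ p : LimitTree s Φ, ∃ i : Fin n, (of i : FreeGroup (Fin n)) • p ≠ p)
    (hrank : ∀ r < n, FinitelyManyRates r) (p : LimitTree s Φ) :
    ∃ Λ : Finset ℝ, (∀ lam ∈ Λ, (1 : ℝ) ≤ lam) ∧
      ∀ x : FreeGroup (Fin n), x ≠ 1 → x • p = p → ∃ lam ∈ Λ, HasGrowthRate Φ x lam := by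
  classical
  by_cases hp : ∀ x : FreeGroup (Fin n), x • p = p → x = 1
  · exact ⟨∅, by simp, fun x hx hxp => absurd (hp x hxp) hx⟩
  push Not at hp
  obtain ⟨x₀, hx₀p, hx₀⟩ := hp
  obtain ⟨m, hm, h, hmh⟩ := LimitTree.exists_iterate_shift_eq hfix hx₀ hx₀p
  obtain ⟨r, hr, ⟨θ⟩⟩ := LimitTree.isArcFreeAction.exists_stabilizer_equiv hfix p
  rw [Fintype.card_fin] at hr
  set G := stabilizer (FreeGroup (Fin n)) p
  have hmem : ∀ x : FreeGroup (Fin n), h⁻¹ * (Φ ^ m) x * h ∈ G ↔ x ∈ G := by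
    intro x
    rw [mem_stabilizer_iff, mem_stabilizer_iff,
      ← LimitTree.iterate_shift_smul_eq_iff (m := m) (x := x),
      hmh, mul_smul, mul_smul, inv_smul_eq_iff]
  let Θ : FreeGroup (Fin n) ≃* FreeGroup (Fin n) := MulAut.conj h⁻¹ * Φ ^ m
  have hΘ : ∀ x, Θ x = h⁻¹ * (Φ ^ m) x * h := fun x => by simp [Θ]
  have hmap : G.map Θ.toMonoidHom = G := by
    ext x
    rw [Subgroup.mem_map_equiv, ← hmem, ← hΘ, MulEquiv.apply_symm_apply]
  let ΘG : G ≃* G := (Θ.subgroupMap G).trans (MulEquiv.subgroupCongr hmap)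
  let Ψ : FreeGroup (Fin r) ≃* FreeGroup (Fin r) := (θ.trans ΘG).trans θ.symm
  let φ : FreeGroup (Fin r) →* FreeGroup (Fin n) := G.subtype.comp θ.toMonoidHom
  have hφ : Function.Injective φ := G.subtype_injective.comp θ.injective
  have hΨ : ∀ y, φ (Ψ y) = h⁻¹ * (Φ ^ m) (φ y) * h := by
    intro y
    rw [← hΘ]
    change ((θ (θ.symm (ΘG (θ y))) : G) : FreeGroup (Fin n)) = _
    rw [MulEquiv.apply_symm_apply]
    rfl
  obtain ⟨Λ, hΛ1, hΛ⟩ := hrank r hr Ψ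
  refine ⟨Λ.image fun μ => μ ^ (1 / (m : ℝ)), ?_, fun x hx hxp => ?_⟩
  · intro lam hlam
    obtain ⟨μ, hμ, rfl⟩ := Finset.mem_image.1 hlam
    exact Real.one_le_rpow (hΛ1 μ hμ) (by positivity)
  · obtain ⟨y, hy⟩ := θ.surjective ⟨x, hxp⟩
    have hyx : φ y = x := congrArg Subtype.val hy
    have hy1 : y ≠ 1 := by
      rintro rfl
      exact hx (by rw [← hyx, _root_.map_one])
    obtain ⟨μ, hμ, hrate⟩ := hΛ y hy1
    refine ⟨_, Finset.mem_image_of_mem _ hμ, ?_⟩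
    rw [← hyx]
    exact hrate.of_subgroup hm hφ hΨ hy1 (hΛ1 μ hμ)

theorem exists_finite_rates_of_isSlow {s : LimitScale}
    {Φ : FreeGroup (Fin n) ≃* FreeGroup (Fin n)}
    (hfix : ∀ p : LimitTree s Φ, ∃ i : Fin n, (of i : FreeGroup (Fin n)) • p ≠ p)
    (hrank : ∀ r < n, FinitelyManyRates r) :
    ∃ Λ : Finset ℝ, (∀ lam ∈ Λ, (1 : ℝ) ≤ lam) ∧
      ∀ x, x ≠ 1 → (s.IsSlow fun k => (cyclicLength ((Φ ^ k) x) : ℤ)) →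
        ∃ lam ∈ Λ, HasGrowthRate Φ x lam := by
  classical
  choose Λ hΛ1 hΛ using exists_finite_rates_of_fixed_point hfix hrank
  have hfin := LimitTree.isArcFreeAction.finite_orbits hfix
  refine ⟨hfin.toFinset.biUnion fun o => Λ o.out, ?_, fun x hx hslow => ?_⟩
  · intro lam hlam
    obtain ⟨o, -, ho⟩ := Finset.mem_biUnion.1 hlam
    exact hΛ1 _ _ ho
  · obtain ⟨p, hp⟩ := LimitTree.exists_smul_eq_iff.2 hslow
    set o : orbitRel.Quotient (FreeGroup (Fin n)) (LimitTree s Φ) := Quotient.mk _ p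
    obtain ⟨g, hg⟩ := orbitRel_apply.1
      (Quotient.mk_out (s := orbitRel (FreeGroup (Fin n)) (LimitTree s Φ)) p)
    change g • p = o.out at hg
    have h1 : (g * x * g⁻¹) • o.out = o.out := by
      rw [← hg]
      simp only [mul_smul, inv_smul_smul, hp]
    have h2 : g * x * g⁻¹ ≠ 1 := by rwa [Ne, conj_eq_one_iff]
    obtain ⟨lam, hlam, hrate⟩ := hΛ _ _ h2 h1
    refine ⟨lam, Finset.mem_biUnion.2 ⟨o, ?_, hlam⟩, ?_⟩
    · rw [Set.Finite.mem_toFinset]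
      intro hbot
      exact h2 ((Subgroup.eq_bot_iff_forall _).1 hbot _ h1)
    · have h3 := hrate.conj g⁻¹
      rwa [show g⁻¹ * (g * x * g⁻¹) * g⁻¹⁻¹ = x by group] at h3

theorem finitelyManyRates (n : ℕ) : FinitelyManyRates n := by
  induction n using Nat.strong_induction_on with
  | _ n ih =>
    intro Φ
    rcases Nat.eq_zero_or_pos n with rfl | hn
    · exact ⟨∅, by simp, fun x hx => absurd (Subsingleton.elim x 1) hx⟩
    obtain ⟨A, hA0, hexp, hA⟩ := exists_outer_rate hn Φ
    rcases hA0.eq_or_lt with rfl | hA0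
    · exact ⟨{1}, by simp, fun x hx => ⟨1, by simp, hasGrowthRate_one hn hA hx⟩⟩
    refine exists_finite_rates_of_slow hn hA0 hA fun s hs => ?_
    exact exists_finite_rates_of_isSlow (LimitTree.exists_smul_ne (by rwa [hs])) ih

end FreeGroup

/-- As `x` ranges over all nontrivial conjugacy classes of `F_n`, only finitely
many asymptotic exponential growth rates `λ_{Φ,x}` occur: there is a finite set
`Λ ⊆ [1, ∞)` such that for every `x ≠ 1` some `λ ∈ Λ` satisfies
`(1/k)·log ‖Φ^k(x)‖_c → log λ`. -/
theorem growth_rates_finite (n : ℕ) (hn : 1 ≤ n)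
    (Φ : FreeGroup (Fin n) ≃* FreeGroup (Fin n)) :
    ∃ Λ : Finset ℝ, (∀ lam ∈ Λ, (1 : ℝ) ≤ lam) ∧
      ∀ x : FreeGroup (Fin n), x ≠ 1 →
        ∃ lam ∈ Λ,
          Filter.Tendsto
            (fun k : ℕ => (1 / (k : ℝ)) * Real.log (cyclicLength ((Φ ^ k) x)))
            Filter.atTop (nhds (Real.log lam)) := by
  exact FreeGroup.finitelyManyRates n Φ
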